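/- Suppose E[ξ⁵] < ∞. Then there exist constants ν₁, ν₂ > 0 such that for all n ∈ I, the expected size of the 2-heavy tree of τ_n satisfies E_{τ_n}[B_n] ≥ ν₁·n + ν₂·√n − 1/2. -/

import Mathlib

/-! Finite ordered rooted (plane) trees: a tree is a finite list of its root subtrees. -/
inductive PTree : Type where
  | node : List PTree → PTree

namespace PTree

/-- the number of nodes of the tree -/
def size : PTree → ℕ
  | node ts => 1 + (ts.attach.map (fun x => size x.1)).sum
decreasing_by
  have := List.sizeOf_lt_of_mem x.2
  simp only [node.sizeOf_spec]; omega

/-- the list of all subtrees rooted at the nodes of the tree -/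
def subtrees : PTree → List PTree
  | node ts => node ts :: (ts.attach.map (fun x => subtrees x.1)).flatten
decreasing_by
  have := List.sizeOf_lt_of_mem x.2
  simp only [node.sizeOf_spec]; omega

/-- the height of the tree (maximal distance from the root to a node) -/
def height : PTree → ℕ
  | node ts => (ts.attach.map (fun x => height x.1 + 1)).foldr max 0
decreasing_by
  have := List.sizeOf_lt_of_mem x.2
  simp only [node.sizeOf_spec]; omega

/-- the number of children of the root (`ξ_ε`) -/
def rootDeg : PTree → ℕ
  | node ts => ts.length

/-- the sizes of the subtrees rooted at the children of the root -/
def childSizes : PTree → List ℕ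
  | node ts => ts.map size

/-- the sizes of the subtrees rooted at the children of the root,
sorted from largest to smallest -/
def sortedSizesDesc (T : PTree) : List ℕ :=
  T.childSizes.insertionSort (· ≥ ·)

/-- `N_k`: the `k`-th largest among the sizes of the subtrees rooted at the children
of the root (`0` if there are fewer than `k` children) -/
def Nk (k : ℕ) (T : PTree) : ℕ := (sortedSizesDesc T).getD (k - 1) 0

/-- `N_{k+} = N_k + N_{k+1} + ⋯` -/
def NkPlus (k : ℕ) (T : PTree) : ℕ := ((sortedSizesDesc T).drop (k - 1)).sum

/-- the subtrees rooted at the nodes of the heavy path: starting at the root, always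
continue to the first child of maximal subtree size -/
def heavyPath : PTree → List PTree
  | node ts =>
    node ts ::
      (match ts.attach.find? (fun x => x.1.size = ((ts.map size).foldr max 0)) with
       | some x => heavyPath x.1
       | none => [])
decreasing_by
  have := List.sizeOf_lt_of_mem x.2
  simp only [node.sizeOf_spec]; omega

end PTree

/-- `Z_k`: the number of nodes `v` of the tree whose subtree has size `k` -/
def Zk (k : ℕ) (T : PTree) : ℕ := (T.subtrees.filter (fun s => s.size = k)).length

/-- the rank (`1` = largest) of the `i`-th child (0-based) among siblings whose subtree
sizes are given by the list `sizes`; ties are broken from left to right -/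
def rankIn (sizes : List ℕ) (i : ℕ) : ℕ :=
  1 + ((List.range sizes.length).filter (fun j =>
        sizes.getD i 0 < sizes.getD j 0 ∨ (sizes.getD j 0 = sizes.getD i 0 ∧ j < i))).length

mutual
/-- the number of nodes of the `k`-heavy tree: the root together with all nodes `v` such
that `v` and every non-root ancestor of `v` has rank at most `k` among its siblings -/
def heavySize (k : ℕ) : PTree → ℕ
  | .node ts => 1 + heavySizeAux k (ts.map PTree.size) 0 ts
def heavySizeAux (k : ℕ) (sizes : List ℕ) : ℕ → List PTree → ℕ
  | _, [] => 0
  | i, t :: rest =>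
      (if rankIn sizes i ≤ k then heavySize k t else 0) + heavySizeAux k sizes (i + 1) rest
end

/-- `H*(v,ℓ)`: the height of the subtree rooted at the child of rank `ℓ` of the root of `v`
(`0` if there are fewer than `ℓ` children) -/
def Hstar : PTree → ℕ → ℕ
  | .node ts, ℓ =>
    match (List.range ts.length).find? (fun i => rankIn (ts.map PTree.size) i = ℓ) with
    | some i => (ts.getD i (.node [])).height
    | none => 0

/-- the weight of a tree: the product over all nodes `v` of `p (number of children of v)` -/
noncomputable def weight (p : ℕ → ℝ) : PTree → ℝ
  | .node ts => p ts.length * (ts.attach.map (fun x => weight p x.1)).prod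
decreasing_by
  have := List.sizeOf_lt_of_mem x.2
  simp only [PTree.node.sizeOf_spec]; omega

/-- the total weight of all trees of size `n` -/
noncomputable def treeSum (p : ℕ → ℝ) (n : ℕ) : ℝ :=
  ∑' T : {T : PTree // T.size = n}, weight p T.1

/-- the probability of the event `A` under the conditional Galton-Watson tree `τ_n` -/
noncomputable def condProb (p : ℕ → ℝ) (n : ℕ) (A : PTree → Prop) : ℝ :=
  (∑' T : {T : PTree // T.size = n ∧ A T}, weight p T.1) / treeSum p n

/-- the expectation of `f` under the conditional Galton-Watson tree `τ_n` -/
noncomputable def condExp (p : ℕ → ℝ) (n : ℕ) (f : PTree → ℝ) : ℝ :=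
  (∑' T : {T : PTree // T.size = n}, weight p T.1 * f T.1) / treeSum p n

/-- the variance of `f` under the conditional Galton-Watson tree `τ_n` -/
noncomputable def condVar (p : ℕ → ℝ) (n : ℕ) (f : PTree → ℝ) : ℝ :=
  condExp p n (fun T => f T ^ 2) - (condExp p n f) ^ 2

/-- the set `I = {n ≥ 1 : Σ_{|T| = n} w(T) > 0}` of sizes of positive probability -/
def gwSupport (p : ℕ → ℝ) : Set ℕ := {n | 1 ≤ n ∧ 0 < treeSum p n}

/-- `P(S_m = x)` for the random walk `S_m = (ξ_1 - 1) + ⋯ + (ξ_m - 1)`, `ξ_i` i.i.d. `∼ p` -/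
noncomputable def walkProb (p : ℕ → ℝ) (m : ℕ) (x : ℤ) : ℝ :=
  ∑' a : Fin m → ℕ, if (∑ i, ((a i : ℤ) - 1)) = x then ∏ i, p (a i) else 0

/-- `I_n = {1 ≤ k ≤ n : P(S_{n-k} = 0) > 0}` -/
def walkSupportIn (p : ℕ → ℝ) (n : ℕ) : Set ℕ :=
  {k | 1 ≤ k ∧ k ≤ n ∧ 0 < walkProb p (n - k) 0}

/-- `h = gcd {i > 0 : p_i > 0}`, defined as the largest common divisor of the support -/
noncomputable def gcdSupp (p : ℕ → ℝ) : ℕ :=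
  sSup {d : ℕ | 0 < d ∧ ∀ i : ℕ, 0 < i → 0 < p i → d ∣ i}

/-- `α = h / (σ √(2π))` where `σ² = Σ i² p_i - 1` -/
noncomputable def gwAlpha (p : ℕ → ℝ) : ℝ :=
  (gcdSupp p : ℝ) /
    (Real.sqrt ((∑' i : ℕ, (i : ℝ) ^ 2 * p i) - 1) * Real.sqrt (2 * Real.pi))

/-- the moment `E[ξ^m] = Σ i^m p_i` is finite -/
def MomentFinite (p : ℕ → ℝ) (m : ℝ) : Prop :=
  Summable (fun i : ℕ => (i : ℝ) ^ m * p i)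

section HeavyTreeSize

open Finset

namespace PTree

lemma size_node (ts : List PTree) : (node ts).size = 1 + (ts.map size).sum := by
  rw [size]
  simp

lemma one_le_size : ∀ T : PTree, 1 ≤ T.size
  | node ts => by rw [size_node]; omega

lemma size_node_ofFn {k : ℕ} (t : Fin k → PTree) :
    (node (List.ofFn t)).size = 1 + ∑ i, (t i).size := by
  rw [size_node, List.map_ofFn, List.sum_ofFn]; rfl

lemma finite_size_eq (n : ℕ) : {T : PTree | T.size = n}.Finite := by
  induction n using Nat.strong_induction_on with
  | _ n ih =>
    have hS : (⋃ m ∈ Finset.range n, {T : PTree | T.size = m}).Finite :=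
      Set.Finite.biUnion (Finset.finite_toSet _) fun m hm => ih m (by simpa using hm)
    set S := ⋃ m ∈ Finset.range n, {T : PTree | T.size = m}
    have hU : (⋃ k ∈ Finset.range n, (fun t : Fin k → PTree => node (List.ofFn t)) ''
        (Set.univ.pi fun _ => S)).Finite :=
      Set.Finite.biUnion (Finset.finite_toSet _) fun k _ => (Set.Finite.pi' fun _ => hS).subset
        (fun t ht => by simpa using ht) |>.image _
    refine hU.subset ?_
    rintro ⟨ts⟩ hT
    rw [Set.mem_ofPred_eq, size_node] at hT
    have hlen : ts.length ≤ (ts.map size).sum := by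
      have := List.card_nsmul_le_sum (ts.map size) 1 (by
        intro x hx
        obtain ⟨T, -, rfl⟩ := List.mem_map.1 hx
        exact one_le_size T)
      simpa using this
    simp only [Set.mem_iUnion]
    refine ⟨ts.length, Finset.mem_range.2 (by omega), ts.get, ?_, by simp⟩
    intro i _
    simp only [S, Set.mem_iUnion]
    refine ⟨(ts.get i).size, Finset.mem_range.2 ?_, rfl⟩
    have := List.single_le_sum (l := ts.map size) (by simp) (ts.get i).size
      (List.mem_map_of_mem (List.get_mem ts i))
    omega

/-- The trees of size `n`. -/
noncomputable def ofSize (n : ℕ) : Finset PTree := (finite_size_eq n).toFinset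

@[simp] lemma mem_ofSize {n : ℕ} {T : PTree} : T ∈ ofSize n ↔ T.size = n := by
  simp [ofSize]

lemma tsum_size_eq (n : ℕ) (F : PTree → ℝ) :
    ∑' T : {T : PTree // T.size = n}, F T.1 = ∑ T ∈ ofSize n, F T := by
  rw [← Finset.tsum_subtype]
  have e : {T : PTree // T.size = n} ≃ {T : PTree // T ∈ ofSize n} :=
    Equiv.subtypeEquivRight fun T => by simp
  exact (Equiv.subtypeEquivRight (fun T : PTree => (mem_ofSize (n := n) (T := T)).symm)).tsum_eq
    (fun x : {T : PTree // T ∈ ofSize n} => F x.1)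

lemma sum_ofSize_succ (n : ℕ) (F : PTree → ℝ) :
    ∑ T ∈ ofSize (n + 1), F T = ∑ k ∈ range (n + 1), ∑ s ∈ Finset.Nat.antidiagonalTuple k n,
      ∑ t ∈ Fintype.piFinset (fun i => ofSize (s i)), F (node (List.ofFn t)) := by
  rw [Finset.sum_sigma', Finset.sum_sigma']
  symm
  refine Finset.sum_bij (fun x _ => node (List.ofFn x.2)) ?_ ?_ ?_ fun _ _ => rfl
  · rintro ⟨⟨k, s⟩, t⟩ h
    simp only [mem_sigma, Finset.Nat.mem_antidiagonalTuple, Fintype.mem_piFinset,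
      mem_ofSize] at h ⊢
    rw [size_node_ofFn, Finset.sum_congr rfl fun i _ => h.2 i, h.1.2, add_comm]
  · rintro ⟨⟨k, s⟩, t⟩ h ⟨⟨k', s'⟩, t'⟩ h' heq
    simp only [mem_sigma, Fintype.mem_piFinset, mem_ofSize] at h h'
    have hl : List.ofFn t = List.ofFn t' := by simpa using heq
    have hk : k = k' := by simpa using congrArg List.length hl
    subst hk
    have ht : t = t' := List.ofFn_injective hl
    subst ht
    have hs : s = s' := funext fun i => (h.2 i).symm.trans (h'.2 i)
    subst hs
    rfl
  · rintro ⟨ts⟩ h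
    rw [mem_ofSize, size_node] at h
    have hsum : ∑ i, (ts.get i).size = n := by
      have := size_node_ofFn ts.get
      rw [List.ofFn_get, size_node] at this
      omega
    have hlen : ts.length ≤ n := by
      calc ts.length = ∑ _i : Fin ts.length, 1 := by simp
        _ ≤ _ := Finset.sum_le_sum fun i _ => one_le_size (ts.get i)
        _ = n := hsum
    refine ⟨⟨⟨ts.length, fun i => (ts.get i).size⟩, ts.get⟩, ?_, by simp⟩
    simp only [mem_sigma, Finset.Nat.mem_antidiagonalTuple, Fintype.mem_piFinset,
      mem_ofSize, mem_range]
    exact ⟨⟨by omega, hsum⟩, fun _ => trivial⟩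

end PTree

open PTree

lemma weight_node_ofFn (p : ℕ → ℝ) {k : ℕ} (t : Fin k → PTree) :
    weight p (.node (List.ofFn t)) = p k * ∏ i, weight p (t i) := by
  have h : ∀ ts : List PTree, weight p (.node ts) = p ts.length * (ts.map (weight p)).prod := by
    intro ts
    rw [weight]
    simp
  rw [h, List.length_ofFn, List.map_ofFn, List.prod_ofFn]; rfl

lemma weight_nonneg {p : ℕ → ℝ} (hp : ∀ i, 0 ≤ p i) (T : PTree) : 0 ≤ weight p T := by
  induction h : T.size using Nat.strong_induction_on generalizing T with
  | _ n ih =>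
    obtain ⟨ts⟩ := T
    obtain ⟨t, ht⟩ : ∃ t : Fin ts.length → PTree, List.ofFn t = ts := ⟨ts.get, by simp⟩
    rw [← ht] at h ⊢
    rw [weight_node_ofFn]
    refine mul_nonneg (hp _) (Finset.prod_nonneg fun i _ => ih _ ?_ (t i) rfl)
    rw [size_node_ofFn] at h
    have := Finset.single_le_sum (f := fun i => (t i).size) (fun _ _ => Nat.zero_le _)
      (mem_univ i)
    omega

lemma treeSum_eq (p : ℕ → ℝ) (n : ℕ) : treeSum p n = ∑ T ∈ ofSize n, weight p T :=
  tsum_size_eq n _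

lemma treeSum_nonneg {p : ℕ → ℝ} (hp : ∀ i, 0 ≤ p i) (n : ℕ) : 0 ≤ treeSum p n := by
  rw [treeSum_eq]
  exact Finset.sum_nonneg fun T _ => weight_nonneg hp T

lemma treeSum_zero (p : ℕ → ℝ) : treeSum p 0 = 0 := by
  rw [treeSum_eq]
  refine Finset.sum_eq_zero fun T hT => ?_
  have := one_le_size T
  rw [mem_ofSize] at hT
  omega

lemma treeSum_succ (p : ℕ → ℝ) (n : ℕ) :
    treeSum p (n + 1) = ∑ k ∈ range (n + 1), p k *
      ∑ s ∈ Finset.Nat.antidiagonalTuple k n, ∏ i, treeSum p (s i) := by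
  rw [treeSum_eq, sum_ofSize_succ]
  refine Finset.sum_congr rfl fun k _ => ?_
  rw [Finset.mul_sum]
  refine Finset.sum_congr rfl fun s _ => ?_
  simp_rw [treeSum_eq]
  rw [Finset.prod_univ_sum, Finset.mul_sum]
  exact Finset.sum_congr rfl fun t _ => weight_node_ofFn p t

lemma heavySizeAux_ofFn (K : ℕ) (sizes : List ℕ) {m : ℕ} (i : ℕ) (t : Fin m → PTree) :
    heavySizeAux K sizes i (List.ofFn t) =
      ∑ j : Fin m, if rankIn sizes (i + j) ≤ K then heavySize K (t j) else 0 := by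
  induction m generalizing i with
  | zero => simp [heavySizeAux]
  | succ m ih =>
    rw [List.ofFn_succ, heavySizeAux, ih, Fin.sum_univ_succ]
    simp only [Fin.val_zero, add_zero, Fin.val_succ]
    congr 1
    refine Finset.sum_congr rfl fun j _ => ?_
    rw [show i + 1 + (j : ℕ) = i + (j + 1) by ring]

lemma heavySize_node_ofFn (K : ℕ) {m : ℕ} (t : Fin m → PTree) :
    heavySize K (.node (List.ofFn t)) =
      1 + ∑ j : Fin m, if rankIn (List.ofFn fun i => (t i).size) j ≤ K
        then heavySize K (t j) else 0 := by
  rw [heavySize, heavySizeAux_ofFn, List.map_ofFn]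
  simp [Function.comp_def]

lemma rankIn_ofFn {m : ℕ} (s : Fin m → ℕ) (i : Fin m) :
    rankIn (List.ofFn s) i =
      1 + #{j : Fin m | s i < s j ∨ (s j = s i ∧ j < i)} := by
  unfold rankIn
  congr 1
  rw [← List.toFinset_card_of_nodup (List.nodup_range.filter _)]
  rw [← Finset.card_map Fin.valEmbedding]
  congr 1
  ext j
  simp only [List.length_ofFn, List.mem_toFinset, List.mem_filter, List.mem_range, mem_map,
    mem_filter, mem_univ, true_and, Fin.valEmbedding_apply, decide_eq_true_eq]
  constructor
  · rintro ⟨hj, h⟩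
    refine ⟨⟨j, hj⟩, ?_, rfl⟩
    simpa [hj, Fin.lt_def] using h
  · rintro ⟨j, h, rfl⟩
    refine ⟨j.2, ?_⟩
    simpa using h

/-- Two distinct children of rank at most two, carrying the two largest subtrees. -/
lemma exists_rankIn_le_two {m : ℕ} (hm : 2 ≤ m) (s : Fin m → ℕ) :
    ∃ i j : Fin m, i ≠ j ∧ rankIn (List.ofFn s) i ≤ 2 ∧ rankIn (List.ofFn s) j ≤ 2 ∧
      s j ≤ s i ∧ ∀ l, l ≠ i → s l ≤ s j := by
  let key : Fin m → ℕ ×ₗ (Fin m)ᵒᵈ := fun i => toLex (s i, OrderDual.toDual i)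
  have hkey : ∀ i j, (s i < s j ∨ (s j = s i ∧ j < i)) ↔ key i < key j := by
    intro i j
    simp only [key, Prod.Lex.toLex_lt_toLex, OrderDual.toDual_lt_toDual]
    exact or_congr_right (and_congr_left' eq_comm)
  have hle : ∀ i j, key i ≤ key j → s i ≤ s j := by
    intro i j h
    rcases Prod.Lex.toLex_le_toLex.1 h with h | h
    · exact h.le
    · exact h.1.le
  obtain ⟨i, -, hi⟩ := Finset.exists_max_image univ key ⟨⟨0, by omega⟩, mem_univ _⟩
  have hne : (univ.erase i).Nonempty := by
    rw [← Finset.card_pos, Finset.card_erase_of_mem (mem_univ _), Finset.card_univ,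
      Fintype.card_fin]
    omega
  obtain ⟨j, hj, hj'⟩ := Finset.exists_max_image (univ.erase i) key hne
  refine ⟨i, j, (Finset.ne_of_mem_erase hj).symm, ?_, ?_, hle _ _ (hi j (mem_univ _)), ?_⟩
  · rw [rankIn_ofFn]
    simp_rw [hkey]
    rw [Finset.filter_eq_empty_iff.2 fun l hl => not_lt.2 (hi l hl)]
    simp
  · rw [rankIn_ofFn]
    simp_rw [hkey]
    have : ({l | key j < key l} : Finset (Fin m)) ⊆ {i} := by
      intro l hl
      rw [mem_filter] at hl
      by_contra hli
      exact absurd hl.2 (not_lt.2 (hj' l (mem_erase.2 ⟨by simpa using hli, mem_univ _⟩)))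
    have := Finset.card_le_card this
    rw [Finset.card_singleton] at this
    omega
  · intro l hl
    exact hle _ _ (hj' l (mem_erase.2 ⟨hl, mem_univ _⟩))

/-- The total weight of the trees of size `n`, each counted with the size of its `2`-heavy tree. -/
noncomputable def heavyMass (p : ℕ → ℝ) (n : ℕ) : ℝ :=
  ∑ T ∈ ofSize n, weight p T * heavySize 2 T

lemma condExp_heavySize (p : ℕ → ℝ) (n : ℕ) :
    condExp p n (fun T => (heavySize 2 T : ℝ)) = heavyMass p n / treeSum p n := by
  rw [condExp, tsum_size_eq n fun T => weight p T * (heavySize 2 T : ℝ), heavyMass]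

lemma heavyMass_nonneg {p : ℕ → ℝ} (hp : ∀ i, 0 ≤ p i) (n : ℕ) : 0 ≤ heavyMass p n :=
  Finset.sum_nonneg fun T _ => mul_nonneg (weight_nonneg hp T) (Nat.cast_nonneg _)

lemma heavyMass_succ (p : ℕ → ℝ) (n : ℕ) :
    heavyMass p (n + 1) = ∑ k ∈ range (n + 1), p k * ∑ s ∈ Finset.Nat.antidiagonalTuple k n,
      ∑ t ∈ Fintype.piFinset (fun i => ofSize (s i)),
        (∏ i, weight p (t i)) * heavySize 2 (.node (List.ofFn t)) := by
  rw [heavyMass, sum_ofSize_succ]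
  refine Finset.sum_congr rfl fun k _ => ?_
  rw [Finset.mul_sum]
  refine Finset.sum_congr rfl fun s _ => ?_
  rw [Finset.mul_sum]
  refine Finset.sum_congr rfl fun t _ => ?_
  rw [weight_node_ofFn]
  ring

lemma sum_piFinset_prod_weight (p : ℕ → ℝ) {k : ℕ} (s : Fin k → ℕ) :
    ∑ t ∈ Fintype.piFinset (fun i => ofSize (s i)), ∏ i, weight p (t i) =
      ∏ i, treeSum p (s i) := by
  simp_rw [treeSum_eq]
  rw [Finset.prod_univ_sum]

lemma sum_piFinset_prod_weight_mul (p : ℕ → ℝ) {k : ℕ} (s : Fin k → ℕ) (j : Fin k) :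
    ∑ t ∈ Fintype.piFinset (fun i => ofSize (s i)), (∏ i, weight p (t i)) * heavySize 2 (t j) =
      heavyMass p (s j) * ∏ i ∈ univ.erase j, treeSum p (s i) := by
  have h := Finset.prod_univ_sum (fun i => ofSize (s i))
    (fun i T => weight p T * (if i = j then (heavySize 2 T : ℝ) else 1))
  have h1 : ∀ t : Fin k → PTree, ∏ i, (weight p (t i) *
      (if i = j then (heavySize 2 (t i) : ℝ) else 1)) =
        (∏ i, weight p (t i)) * heavySize 2 (t j) := by
    intro t
    rw [Finset.prod_mul_distrib, Finset.prod_ite_eq' univ j fun i => (heavySize 2 (t i) : ℝ)]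
    simp
  simp_rw [h1] at h
  rw [← h, ← Finset.mul_prod_erase univ _ (mem_univ j)]
  simp only [if_true]
  congr 1
  refine Finset.prod_congr rfl fun i hi => ?_
  simp [Finset.ne_of_mem_erase hi, treeSum_eq]

lemma prod_treeSum_mul_le {p : ℕ → ℝ} (hp : ∀ i, 0 ≤ p i) {k : ℕ} (s : Fin k → ℕ) (j : Fin k)
    {b : ℝ} (hb : treeSum p (s j) * b ≤ heavyMass p (s j)) :
    (∏ i, treeSum p (s i)) * b ≤
      ∑ t ∈ Fintype.piFinset (fun i => ofSize (s i)),
        (∏ i, weight p (t i)) * heavySize 2 (t j) := by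
  rw [sum_piFinset_prod_weight_mul, ← Finset.mul_prod_erase univ _ (mem_univ j)]
  have h : 0 ≤ ∏ i ∈ univ.erase j, treeSum p (s i) :=
    Finset.prod_nonneg fun i _ => treeSum_nonneg hp _
  calc _ = (treeSum p (s j) * b) * ∏ i ∈ univ.erase j, treeSum p (s i) := by ring
    _ ≤ _ := mul_le_mul_of_nonneg_right hb h

lemma prod_treeSum_mul_two_heavy_le {p : ℕ → ℝ} (hp : ∀ i, 0 ≤ p i) {k : ℕ} (hk : 2 ≤ k)
    (s : Fin k → ℕ) {b : ℕ → ℝ}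
    (hb : ∀ i, treeSum p (s i) * b (s i) ≤ heavyMass p (s i)) :
    ∃ i j : Fin k, i ≠ j ∧ s j ≤ s i ∧ (∀ l, l ≠ i → s l ≤ s j) ∧
      (∏ i, treeSum p (s i)) * (1 + b (s i) + b (s j)) ≤
        ∑ t ∈ Fintype.piFinset (fun i => ofSize (s i)),
          (∏ i, weight p (t i)) * heavySize 2 (.node (List.ofFn t)) := by
  obtain ⟨i, j, hij, hi, hj, hle, hmax⟩ := exists_rankIn_le_two hk s
  refine ⟨i, j, hij, hle, hmax, ?_⟩
  have h0 := sum_piFinset_prod_weight p s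
  have h1 := prod_treeSum_mul_le hp s i (hb i)
  have h2 := prod_treeSum_mul_le hp s j (hb j)
  calc _ = (∏ i, treeSum p (s i)) + (∏ i, treeSum p (s i)) * b (s i)
        + (∏ i, treeSum p (s i)) * b (s j) := by ring
    _ ≤ _ := add_le_add (add_le_add h0.ge h1) h2
    _ ≤ _ := by
      rw [← Finset.sum_add_distrib, ← Finset.sum_add_distrib]
      refine Finset.sum_le_sum fun t ht => ?_
      have hs : (fun i => (t i).size) = s :=
        funext fun i => mem_ofSize.1 (Fintype.mem_piFinset.1 ht i)
      have hB : 1 + heavySize 2 (t i) + heavySize 2 (t j) ≤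
          heavySize 2 (.node (List.ofFn t)) := by
        rw [heavySize_node_ofFn, hs, add_assoc]
        refine Nat.add_le_add_left ?_ _
        rw [← Finset.sum_pair (f := fun i => heavySize 2 (t i)) hij]
        calc _ = ∑ l ∈ {i, j}, if rankIn (List.ofFn s) l ≤ 2 then heavySize 2 (t l) else 0 := by
              refine Finset.sum_congr rfl fun l hl => ?_
              rcases Finset.mem_insert.1 hl with rfl | hl
              · rw [if_pos hi]
              · rw [Finset.mem_singleton.1 hl, if_pos hj]
          _ ≤ _ := Finset.sum_le_sum_of_subset (subset_univ _)
      have hB' : (1 : ℝ) + heavySize 2 (t i) + heavySize 2 (t j) ≤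
          heavySize 2 (.node (List.ofFn t)) := by exact_mod_cast hB
      have hw : 0 ≤ ∏ i, weight p (t i) := Finset.prod_nonneg fun i _ => weight_nonneg hp _
      calc _ = (∏ i, weight p (t i)) * (1 + heavySize 2 (t i) + heavySize 2 (t j)) := by ring
        _ ≤ _ := mul_le_mul_of_nonneg_left hB' hw

lemma prod_treeSum_mul_one_heavy_le {p : ℕ → ℝ} (hp : ∀ i, 0 ≤ p i)
    (s : Fin 1 → ℕ) {b : ℝ} (hb : treeSum p (s 0) * b ≤ heavyMass p (s 0)) :
    (∏ i, treeSum p (s i)) * (1 + b) ≤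
      ∑ t ∈ Fintype.piFinset (fun i => ofSize (s i)),
        (∏ i, weight p (t i)) * heavySize 2 (.node (List.ofFn t)) := by
  have h0 := sum_piFinset_prod_weight p s
  have h1 := prod_treeSum_mul_le hp s 0 hb
  calc _ = (∏ i, treeSum p (s i)) + (∏ i, treeSum p (s i)) * b := by ring
    _ ≤ _ := add_le_add h0.ge h1
    _ ≤ _ := by
      rw [← Finset.sum_add_distrib]
      refine Finset.sum_le_sum fun t ht => ?_
      have hB : heavySize 2 (.node (List.ofFn t)) = 1 + heavySize 2 (t 0) := by
        rw [heavySize_node_ofFn, Fin.sum_univ_one, if_pos]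
        rw [rankIn_ofFn]
        exact Nat.add_le_add_left (Finset.card_le_univ _) 1
      rw [hB]
      push_cast
      exact le_of_eq (by ring)

lemma sum_antidiagonalTuple_prod (q : ℕ → ℝ) (k n : ℕ) :
    ∑ s ∈ Finset.Nat.antidiagonalTuple k n, ∏ i, q (s i) =
      PowerSeries.coeff n (PowerSeries.mk q ^ k) := by
  induction k generalizing n with
  | zero =>
    cases n with
    | zero => simp
    | succ n => simp [PowerSeries.coeff_one]
  | succ k ih =>
    rw [pow_succ', PowerSeries.coeff_mul]
    simp_rw [← ih, PowerSeries.coeff_mk, Finset.mul_sum]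
    rw [Finset.sum_sigma']
    refine Finset.sum_bij' (fun s _ => ⟨(s 0, ∑ i : Fin k, s i.succ), Fin.tail s⟩)
      (fun x _ => Fin.cons x.1.1 x.2) ?_ ?_ ?_ ?_ ?_
    · intro s hs
      rw [Finset.Nat.mem_antidiagonalTuple, Fin.sum_univ_succ] at hs
      simp [Finset.Nat.mem_antidiagonalTuple, hs, Fin.tail]
    · rintro ⟨⟨a, b⟩, s⟩ hs
      simp only [mem_sigma, HasAntidiagonal.mem_antidiagonal, Finset.Nat.mem_antidiagonalTuple] at hs ⊢
      rw [Fin.sum_univ_succ]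
      simp [hs.1, hs.2]
    · intro s _
      simp
    · rintro ⟨⟨a, b⟩, s⟩ hs
      simp only [mem_sigma, HasAntidiagonal.mem_antidiagonal, Finset.Nat.mem_antidiagonalTuple] at hs
      simp [hs.2]
    · intro s _
      rw [Fin.prod_univ_succ]
      rfl

section OtterDwass

variable {p q : ℕ → ℝ}

lemma coeff_mk_pow_eq_zero (hq0 : q 0 = 0) {k n : ℕ} (h : n < k) :
    PowerSeries.coeff n (PowerSeries.mk q ^ k) = 0 := by
  have hX : (PowerSeries.X : PowerSeries ℝ) ∣ PowerSeries.mk q := by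
    rw [PowerSeries.X_dvd_iff]; simpa using hq0
  exact PowerSeries.X_pow_dvd_iff.1 (pow_dvd_pow_of_dvd hX k) n h

lemma coeff_mk_pow_succ (hq0 : q 0 = 0)
    (hq : ∀ n, q (n + 1) = ∑ k ∈ range (n + 1), p k *
      PowerSeries.coeff n (PowerSeries.mk q ^ k)) (k n : ℕ) :
    PowerSeries.coeff (n + 1) (PowerSeries.mk q ^ (k + 1)) =
      ∑ j ∈ range (n + 1), p j * PowerSeries.coeff n (PowerSeries.mk q ^ (j + k)) := by
  rw [pow_succ', PowerSeries.coeff_mul, Finset.Nat.sum_antidiagonal_succ]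
  simp only [PowerSeries.coeff_mk, hq0, zero_mul, zero_add]
  have h1 : ∀ x ∈ HasAntidiagonal.antidiagonal n, q (x.1 + 1) * PowerSeries.coeff x.2 (PowerSeries.mk q ^ k) =
      ∑ j ∈ range (n + 1), p j * (PowerSeries.coeff x.1 (PowerSeries.mk q ^ j) *
        PowerSeries.coeff x.2 (PowerSeries.mk q ^ k)) := by
    intro x hx
    rw [hq, Finset.sum_mul]
    have hx1 : x.1 ≤ n := by
      have := HasAntidiagonal.mem_antidiagonal.1 hx
      omega
    rw [← Finset.sum_subset (Finset.range_mono (Nat.succ_le_succ hx1))]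
    · exact Finset.sum_congr rfl fun j _ => by rw [mul_assoc]
    · intro j _ hj
      rw [coeff_mk_pow_eq_zero hq0 (by simpa using hj)]
      ring
  rw [Finset.sum_congr rfl h1, Finset.sum_comm]
  refine Finset.sum_congr rfl fun j _ => ?_
  rw [← Finset.mul_sum, pow_add, PowerSeries.coeff_mul]

/-- The coefficient of `z ^ m` in the `n`-th power of `∑ p i z ^ i`, i.e. the probability that
`n` independent variables with distribution `p` sum to `m`. -/
noncomputable def powCoeff (p : ℕ → ℝ) (n m : ℕ) : ℝ :=
  PowerSeries.coeff m (PowerSeries.mk p ^ n)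

lemma powCoeff_succ (p : ℕ → ℝ) (n m : ℕ) :
    powCoeff p (n + 1) m = ∑ j ∈ range (m + 1), p j * powCoeff p n (m - j) := by
  rw [powCoeff, pow_succ', PowerSeries.coeff_mul, Finset.Nat.sum_antidiagonal_eq_sum_range_succ
    (fun i j => PowerSeries.coeff i (PowerSeries.mk p) *
      PowerSeries.coeff j (PowerSeries.mk p ^ n))]
  simp [powCoeff]

lemma sum_mul_powCoeff (p : ℕ → ℝ) (n m : ℕ) :
    (n + 1) * ∑ j ∈ range (m + 1), (j : ℝ) * p j * powCoeff p n (m - j) =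
      m * powCoeff p (n + 1) m := by
  cases m with
  | zero => simp
  | succ m =>
    have h := congrArg (PowerSeries.coeff m)
      (Derivation.leibniz_pow (PowerSeries.derivative ℝ) (PowerSeries.mk p) (n + 1))
    rw [PowerSeries.coeff_derivative, map_nsmul, nsmul_eq_mul, smul_eq_mul, add_tsub_cancel_right,
      mul_comm (PowerSeries.mk p ^ n)] at h
    rw [Finset.sum_range_succ', show ((m + 1 : ℕ) : ℝ) * powCoeff p (n + 1) (m + 1) = _ by
      rw [Nat.cast_succ, mul_comm, powCoeff, h]]
    rw [PowerSeries.coeff_mul, Finset.Nat.sum_antidiagonal_eq_sum_range_succ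
      (fun i j => PowerSeries.coeff i (PowerSeries.derivative ℝ (PowerSeries.mk p)) *
      PowerSeries.coeff j (PowerSeries.mk p ^ n))]
    push_cast
    simp only [PowerSeries.coeff_derivative, PowerSeries.coeff_mk, zero_mul, add_zero, powCoeff]
    congr 1
    exact Finset.sum_congr rfl fun j _ => by ring

/-- The Otter–Dwass formula for forests. -/
lemma otter_dwass (hq0 : q 0 = 0)
    (hq : ∀ n, q (n + 1) = ∑ k ∈ range (n + 1), p k *
      PowerSeries.coeff n (PowerSeries.mk q ^ k)) (n k : ℕ) (hk : k ≤ n + 1) :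
    (n + 1) * PowerSeries.coeff (n + 1) (PowerSeries.mk q ^ k) =
      k * powCoeff p (n + 1) (n + 1 - k) := by
  induction n generalizing k with
  | zero =>
    interval_cases k
    · simp [PowerSeries.coeff_one]
    · simp [hq, powCoeff]
  | succ n ih =>
    cases k with
    | zero => simp [PowerSeries.coeff_one]
    | succ k =>
      have hk' : k ≤ n + 1 := by omega
      obtain ⟨m, hm⟩ := Nat.exists_eq_add_of_le hk'
      have h1 := coeff_mk_pow_succ hq0 hq k (n + 1)
      have h2 : ∀ j ∈ range (m + 1),
          (n + 1) * (p j * PowerSeries.coeff (n + 1) (PowerSeries.mk q ^ (j + k))) =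
            (j * p j * powCoeff p (n + 1) (m - j) + k * (p j * powCoeff p (n + 1) (m - j))) := by
        intro j hj
        have hjm : j ≤ m := by simpa [Nat.lt_succ_iff] using hj
        have := ih (j + k) (by omega)
        rw [show n + 1 - (j + k) = m - j by omega] at this
        rw [mul_left_comm, this]
        push_cast
        ring
      have h3 : (n + 1 : ℝ) * PowerSeries.coeff (n + 1 + 1) (PowerSeries.mk q ^ (k + 1)) =
          ∑ j ∈ range (m + 1),
            (j * p j * powCoeff p (n + 1) (m - j) + k * (p j * powCoeff p (n + 1) (m - j))) := by
        rw [h1, ← Finset.sum_congr rfl h2, ← Finset.mul_sum]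
        congr 1
        symm
        refine Finset.sum_subset (Finset.range_mono (by omega)) fun j _ hj => ?_
        rw [coeff_mk_pow_eq_zero hq0, mul_zero]
        simp only [mem_range, not_lt] at hj
        omega
      rw [Finset.sum_add_distrib, ← Finset.mul_sum, ← powCoeff_succ] at h3
      have h4 := sum_mul_powCoeff p (n + 1) m
      rw [show n + 1 + 1 - (k + 1) = m by omega]
      have hn : (n + 1 : ℝ) ≠ 0 := by positivity
      have hmk : (n : ℝ) + 1 = k + m := by exact_mod_cast hm
      apply mul_left_cancel₀ hn
      push_cast at h4 ⊢
      have hm' : (m : ℝ) = n + 1 - k := by linarith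
      rw [hm'] at h4
      linear_combination (n + 1 + 1 : ℝ) * h3 + h4

end OtterDwass

section LocalLimit

open Filter Topology MeasureTheory

/-- The character `t ↦ exp (i m t)`. -/
noncomputable def expChar (m : ℝ) (t : ℝ) : ℂ := Complex.exp ((m * t : ℝ) * Complex.I)

lemma norm_expChar (m t : ℝ) : ‖expChar m t‖ = 1 := Complex.norm_exp_ofReal_mul_I _

lemma expChar_add (m l t : ℝ) : expChar (m + l) t = expChar m t * expChar l t := by
  rw [expChar, expChar, expChar, ← Complex.exp_add]
  push_cast
  ring_nf

@[fun_prop] lemma continuous_expChar (m : ℝ) : Continuous (expChar m) := by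
  unfold expChar
  fun_prop

/-- The characteristic function of the distribution `p`. -/
noncomputable def charSeries (p : ℕ → ℝ) (t : ℝ) : ℂ := ∑' k : ℕ, (p k : ℂ) * expChar k t

variable {p : ℕ → ℝ}

lemma powCoeff_nonneg (hp : ∀ i, 0 ≤ p i) (n m : ℕ) : 0 ≤ powCoeff p n m := by
  induction n generalizing m with
  | zero => simp only [powCoeff, pow_zero, PowerSeries.coeff_one]; split_ifs <;> simp
  | succ n ih =>
    rw [powCoeff_succ]
    exact Finset.sum_nonneg fun j _ => mul_nonneg (hp j) (ih _)

lemma norm_ofReal_mul_expChar (a m t : ℝ) : ‖(a : ℂ) * expChar m t‖ = |a| := by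
  rw [norm_mul, norm_expChar, mul_one, Complex.norm_real, Real.norm_eq_abs]

lemma powCoeff_series (hs : Summable p) (n : ℕ) (t : ℝ) :
    Summable (fun m => ‖(powCoeff p n m : ℂ) * expChar m t‖) ∧
      ∑' m : ℕ, (powCoeff p n m : ℂ) * expChar m t = charSeries p t ^ n := by
  induction n with
  | zero =>
    have h : ∀ m ≠ 0, (powCoeff p 0 m : ℂ) * expChar m t = 0 := by
      intro m hm
      simp [powCoeff, PowerSeries.coeff_one, hm]
    constructor
    · refine summable_of_ne_finset_zero (s := {0}) fun m hm => ?_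
      rw [h m (by simpa using hm), norm_zero]
    · rw [tsum_eq_single 0 h]
      simp [powCoeff, expChar]
  | succ n ih =>
    have hf : Summable fun k : ℕ => ‖(p k : ℂ) * expChar k t‖ := by
      simp_rw [norm_ofReal_mul_expChar]
      exact hs.abs
    have key : ∀ m, (powCoeff p (n + 1) m : ℂ) * expChar m t =
        ∑ x ∈ HasAntidiagonal.antidiagonal m,
          ((p x.1 : ℂ) * expChar x.1 t) * ((powCoeff p n x.2 : ℂ) * expChar x.2 t) := by
      intro m
      rw [powCoeff_succ, Finset.Nat.sum_antidiagonal_eq_sum_range_succ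
        (fun i j => ((p i : ℂ) * expChar i t) * ((powCoeff p n j : ℂ) * expChar j t))]
      push_cast
      rw [Finset.sum_mul]
      refine Finset.sum_congr rfl fun j hj => ?_
      have hj : j ≤ m := by simpa [Nat.lt_succ_iff] using hj
      have : expChar m t = expChar j t * expChar (m - j : ℕ) t := by
        rw [← expChar_add]
        congr 1
        push_cast [hj]
        ring
      rw [this]
      ring
    have h1 := summable_norm_sum_mul_antidiagonal_of_summable_norm (f := fun k : ℕ =>
      (p k : ℂ) * expChar k t) (g := fun k : ℕ => (powCoeff p n k : ℂ) * expChar k t) hf ih.1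
    have h2 := tsum_mul_tsum_eq_tsum_sum_antidiagonal_of_summable_norm (f := fun k : ℕ =>
      (p k : ℂ) * expChar k t) (g := fun k : ℕ => (powCoeff p n k : ℂ) * expChar k t) hf ih.1
    simp only [← key] at h1 h2
    refine ⟨h1, ?_⟩
    rw [← h2, ih.2, pow_succ', charSeries]

lemma summable_powCoeff (hp : ∀ i, 0 ≤ p i) (hs : Summable p) (n : ℕ) :
    Summable (powCoeff p n) := by
  have := (powCoeff_series hs n 0).1
  simp_rw [norm_ofReal_mul_expChar, abs_of_nonneg (powCoeff_nonneg hp _ _)] at this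
  exact this

lemma powCoeff_eq_zero_of_not_dvd {h : ℕ} (hh : ∀ i, p i ≠ 0 → h ∣ i) (n : ℕ) {m : ℕ}
    (hm : ¬ h ∣ m) : powCoeff p n m = 0 := by
  induction n generalizing m with
  | zero =>
    have : m ≠ 0 := by rintro rfl; exact hm (dvd_zero h)
    simp [powCoeff, PowerSeries.coeff_one, this]
  | succ n ih =>
    rw [powCoeff_succ]
    refine Finset.sum_eq_zero fun j hj => ?_
    by_cases hpj : p j = 0
    · rw [hpj, zero_mul]
    · rw [ih, mul_zero]
      have hj : j ≤ m := by simpa [Nat.lt_succ_iff] using hj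
      intro hd
      apply hm
      have := (Nat.dvd_add (hh j hpj) hd)
      rwa [Nat.add_sub_cancel' hj] at this

lemma continuous_charSeries (hs : Summable p) : Continuous (charSeries p) := by
  refine continuous_tsum (u := fun k => |p k|) (fun k => by fun_prop) hs.abs fun k t => ?_
  rw [norm_ofReal_mul_expChar]

lemma integral_expChar_period {h : ℕ} (hh : 0 < h) {d : ℤ} (hd : d ≠ 0) :
    ∫ t in -(Real.pi / h)..(Real.pi / h), expChar (h * d) t = 0 := by
  have hh' : (h : ℂ) ≠ 0 := by exact_mod_cast hh.ne'
  have hd' : (d : ℂ) ≠ 0 := by exact_mod_cast hd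
  have hc : ((h * d : ℂ) * Complex.I) ≠ 0 := by simp [hh', hd']
  have : ∀ t, expChar (h * d) t = Complex.exp (((h * d : ℂ) * Complex.I) * (t : ℂ)) := by
    intro t
    rw [expChar]
    push_cast
    ring_nf
  simp_rw [this]
  rw [integral_exp_mul_complex hc, div_eq_zero_iff]
  left
  rw [sub_eq_zero, Complex.exp_eq_exp_iff_exists_int]
  refine ⟨d, ?_⟩
  push_cast
  field_simp
  ring

lemma integral_charSeries_pow (hp : ∀ i, 0 ≤ p i) (hs : Summable p) {h : ℕ} (hh : 0 < h)
    (hdvd : ∀ i, p i ≠ 0 → h ∣ i) (n : ℕ) {m : ℕ} (hm : h ∣ m) :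
    ∫ t in -(Real.pi / h)..(Real.pi / h), charSeries p t ^ n * expChar (-m) t =
      (2 * Real.pi / h : ℝ) * powCoeff p n m := by
  have H := intervalIntegral.hasSum_integral_of_dominated_convergence
    (a := -(Real.pi / h)) (b := Real.pi / h) (μ := volume)
    (F := fun (l : ℕ) t => (powCoeff p n l : ℂ) * expChar l t * expChar (-m) t)
    (f := fun t => charSeries p t ^ n * expChar (-m) t)
    (fun l _ => powCoeff p n l)
    (fun l => (by fun_prop : Continuous _).aestronglyMeasurable)
    (fun l => ae_of_all _ fun t _ => by
      rw [norm_mul, norm_ofReal_mul_expChar, norm_expChar, mul_one,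
        abs_of_nonneg (powCoeff_nonneg hp _ _)])
    (ae_of_all _ fun t _ => summable_powCoeff hp hs n)
    (by simp)
    (ae_of_all _ fun t _ => by
      obtain ⟨h1, h2⟩ := powCoeff_series hs n t
      exact (h2 ▸ h1.of_norm.hasSum).mul_right _)
  rw [← H.tsum_eq, tsum_eq_single m]
  · have : ∀ t, (powCoeff p n m : ℂ) * expChar m t * expChar (-m) t = powCoeff p n m := by
      intro t
      rw [mul_assoc, ← expChar_add]
      simp [expChar]
    simp_rw [this]
    rw [intervalIntegral.integral_const, ← Complex.coe_smul, smul_eq_mul]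
    push_cast
    ring
  · intro l hl
    by_cases hl' : h ∣ l
    · obtain ⟨a, rfl⟩ := hl'
      obtain ⟨b, rfl⟩ := hm
      have hab : (a : ℤ) - b ≠ 0 := by
        intro hab
        apply hl
        have : a = b := by omega
        rw [this]
      have : ∀ t, (powCoeff p n (h * a) : ℂ) * expChar (h * a : ℕ) t * expChar (-(h * b : ℕ)) t =
          powCoeff p n (h * a) * expChar (h * ((a - b : ℤ) : ℝ)) t := by
        intro t
        rw [mul_assoc, ← expChar_add]
        congr 2
        push_cast
        ring
      simp_rw [this]
      rw [intervalIntegral.integral_const_mul, integral_expChar_period hh hab, mul_zero]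
    · simp [powCoeff_eq_zero_of_not_dvd hdvd n hl']

lemma norm_add_mul_expChar_le {a b : ℝ} (ha : 0 ≤ a) (hb : 0 ≤ b) (hab : a + b ≤ 1) (θ t : ℝ) :
    ‖(a : ℂ) + b * expChar θ t‖ ≤ a + b - a * b * (1 - Real.cos (θ * t)) := by
  have hc1 := Real.cos_le_one (θ * t)
  have hc2 := Real.neg_one_le_cos (θ * t)
  have hsc := Real.sin_sq_add_cos_sq (θ * t)
  have hE : expChar θ t = Real.cos (θ * t) + Real.sin (θ * t) * Complex.I := by
    rw [expChar, Complex.exp_mul_I]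
    push_cast
    rfl
  set x := Real.cos (θ * t)
  set y := Real.sin (θ * t)
  have hd : 0 ≤ a * b * (1 - x) := mul_nonneg (mul_nonneg ha hb) (by linarith)
  have hd' : a * b * (1 - x) ≤ a + b := by
    have : a * b * (1 - x) ≤ a * b * 2 := mul_le_mul_of_nonneg_left (by linarith) (by positivity)
    nlinarith
  refine le_of_sq_le_sq ?_ (by linarith)
  rw [hE, Complex.sq_norm, Complex.normSq_apply]
  simp only [Complex.add_re, Complex.mul_re, Complex.ofReal_re, Complex.ofReal_im, Complex.I_re,
    Complex.I_im, Complex.add_im, Complex.mul_im]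
  ring_nf
  ring_nf at hd hd'
  nlinarith [mul_nonneg (sub_nonneg.2 hab) hd, sq_nonneg (a * b * (1 - x))]

lemma mul_one_sub_cos_le (hp : ∀ i, 0 ≤ p i) (hs : HasSum p 1) (k : ℕ) (t : ℝ) :
    p 0 * p k * (1 - Real.cos (k * t)) ≤ 1 - ‖charSeries p t‖ := by
  have hf : Summable fun k : ℕ => ‖(p k : ℂ) * expChar k t‖ := by
    simp_rw [norm_ofReal_mul_expChar]
    exact hs.summable.abs
  have hn : ∀ k : ℕ, ‖(p k : ℂ) * expChar k t‖ = p k := fun k => by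
    rw [norm_ofReal_mul_expChar, abs_of_nonneg (hp k)]
  rcases eq_or_ne k 0 with rfl | hk
  · have h1 : ‖charSeries p t‖ ≤ ∑' k : ℕ, ‖(p k : ℂ) * expChar k t‖ := norm_tsum_le_tsum_norm hf
    simp_rw [hn, hs.tsum_eq] at h1
    simpa using h1
  · have h1 := hf.of_norm.sum_add_tsum_compl (s := {0, k})
    have h2 := hs.summable.sum_add_tsum_compl (s := {0, k})
    rw [Finset.sum_pair hk.symm] at h1 h2
    rw [hs.tsum_eq] at h2
    have h3 : ‖∑' x : {x // x ∉ ({0, k} : Finset ℕ)}, (p x : ℂ) * expChar (x : ℕ) t‖ ≤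
        ∑' x : {x // x ∉ ({0, k} : Finset ℕ)}, p x := by
      refine (norm_tsum_le_tsum_norm (hf.subtype _)).trans_eq ?_
      exact tsum_congr fun x => hn x
    have h5 : 0 ≤ ∑' x : {x // x ∉ ({0, k} : Finset ℕ)}, p x := tsum_nonneg fun x => hp x
    have h2' : p 0 + p k + ∑' x : {x // x ∉ ({0, k} : Finset ℕ)}, p x = 1 := h2
    have h4 := norm_add_mul_expChar_le (hp 0) (hp k) (by linarith) k t
    have h0 : expChar ((0 : ℕ) : ℝ) t = 1 := by simp [expChar]
    rw [h0, mul_one] at h1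
    have h6 : ‖charSeries p t‖ ≤ (p 0 + p k - p 0 * p k * (1 - Real.cos (k * t))) +
        ∑' x : {x // x ∉ ({0, k} : Finset ℕ)}, p x := by
      rw [charSeries, ← h1]
      exact (norm_add_le _ _).trans (add_le_add h4 h3)
    linarith

lemma one_sub_cos_add_le (x y : ℝ) :
    1 - Real.cos (x + y) ≤ 2 * (1 - Real.cos x) + 2 * (1 - Real.cos y) := by
  have h : ∀ z : ℝ, 1 - Real.cos z = 2 * Real.sin (z / 2) ^ 2 := by
    intro z
    have := Real.cos_sq (z / 2)
    have := Real.sin_sq_add_cos_sq (z / 2)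
    rw [mul_div_cancel₀ z two_ne_zero] at *
    linarith
  rw [h, h, h, add_div, Real.sin_add]
  set a := Real.sin (x / 2)
  set b := Real.sin (y / 2)
  have ha : Real.cos (x / 2) ^ 2 ≤ 1 := Real.cos_sq_le_one _
  have hb : Real.cos (y / 2) ^ 2 ≤ 1 := Real.cos_sq_le_one _
  set a' := Real.cos (x / 2)
  set b' := Real.cos (y / 2)
  nlinarith [sq_nonneg (a * b' - a' * b), mul_le_mul_of_nonneg_left hb (sq_nonneg a),
    mul_le_mul_of_nonneg_left ha (sq_nonneg b)]

/-- The frequencies on which `1 - ‖charSeries p‖` controls `1 - cos`. -/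
def controlledFreq (p : ℕ → ℝ) : AddSubgroup ℤ where
  carrier := {z | ∃ C : ℝ, 0 ≤ C ∧ ∀ t : ℝ,
    1 - Real.cos (z * t) ≤ C * (1 - ‖charSeries p t‖)}
  zero_mem' := ⟨0, le_rfl, fun t => by simp⟩
  add_mem' := by
    rintro a b ⟨A, hA, ha⟩ ⟨B, hB, hb⟩
    refine ⟨2 * A + 2 * B, by positivity, fun t => ?_⟩
    have := one_sub_cos_add_le (a * t) (b * t)
    push_cast
    rw [add_mul]
    nlinarith [ha t, hb t]
  neg_mem' := by
    rintro a ⟨A, hA, ha⟩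
    refine ⟨A, hA, fun t => ?_⟩
    push_cast
    rw [neg_mul, Real.cos_neg]
    exact ha t

lemma natCast_mem_controlledFreq (hp : ∀ i, 0 ≤ p i) (hs : HasSum p 1) (h0 : p 0 ≠ 0) {k : ℕ}
    (hk : p k ≠ 0) : (k : ℤ) ∈ controlledFreq p := by
  have h0' : 0 < p 0 := lt_of_le_of_ne (hp 0) h0.symm
  have hk' : 0 < p k := lt_of_le_of_ne (hp k) hk.symm
  refine ⟨(p 0 * p k)⁻¹, by positivity, fun t => ?_⟩
  rw [le_inv_mul_iff₀ (by positivity)]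
  exact_mod_cast mul_one_sub_cos_le hp hs k t

/-- The span of the distribution, and the Gaussian decay of its characteristic function on a
period. -/
lemma exists_span (hp : ∀ i, 0 ≤ p i) (hs : HasSum p 1) (h0 : p 0 ≠ 0) {k : ℕ} (hk0 : k ≠ 0)
    (hk : p k ≠ 0) : ∃ h : ℕ, 0 < h ∧ (∀ i, p i ≠ 0 → h ∣ i) ∧ ∃ c > 0, ∀ t : ℝ,
      |t| ≤ Real.pi / h → ‖charSeries p t‖ ≤ Real.exp (-c * t ^ 2) := by
  obtain ⟨a, ha⟩ := Int.subgroup_cyclic (controlledFreq p)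
  have hdvd : ∀ i, p i ≠ 0 → a.natAbs ∣ i := by
    intro i hi
    have := natCast_mem_controlledFreq hp hs h0 hi
    rw [ha, AddSubgroup.mem_closure_singleton] at this
    obtain ⟨n, hn⟩ := this
    exact Int.natCast_dvd_natCast.1 (Int.natAbs_dvd.2 ⟨n, by rw [← hn, smul_eq_mul, mul_comm]⟩)
  have ha0 : 0 < a.natAbs := by
    rcases Nat.eq_zero_or_pos a.natAbs with h | h
    · exact absurd (Nat.eq_zero_of_zero_dvd (h ▸ hdvd k hk)) hk0
    · exact h
  have hmem : (a.natAbs : ℤ) ∈ controlledFreq p := by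
    rw [ha, AddSubgroup.mem_closure_singleton]
    rcases Int.natAbs_eq a with h | h
    · exact ⟨1, by rw [one_smul]; exact h⟩
    · exact ⟨-1, by rw [neg_smul, one_smul]; omega⟩
  obtain ⟨C, hC, hCt⟩ := hmem
  set h := a.natAbs
  have hh : (0 : ℝ) < h := by exact_mod_cast ha0
  refine ⟨h, ha0, hdvd, 2 / Real.pi ^ 2 * h ^ 2 / (C + 1), by positivity, fun t ht => ?_⟩
  have h1 : |h * t| ≤ Real.pi := by
    rw [abs_mul, abs_of_pos hh]
    rwa [le_div_iff₀' hh] at ht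
  have h2 := Real.cos_le_one_sub_mul_cos_sq h1
  have h3 := hCt t
  have h4 : 0 ≤ 1 - ‖charSeries p t‖ := by simpa using mul_one_sub_cos_le hp hs 0 t
  have h5 : 2 / Real.pi ^ 2 * h ^ 2 / (C + 1) * t ^ 2 ≤ 1 - ‖charSeries p t‖ := by
    rw [div_mul_eq_mul_div, div_le_iff₀ (by positivity)]
    push_cast at h3
    rw [mul_pow] at h2
    nlinarith
  have := Real.add_one_le_exp (-(2 / Real.pi ^ 2 * h ^ 2 / (C + 1)) * t ^ 2)
  linarith

lemma norm_expChar_sub_le (m t : ℝ) :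
    ‖expChar m t - 1 - (m * t : ℝ) * Complex.I‖ ≤ 2 * (m * t) ^ 2 := by
  set x := m * t with hx
  have hn : ‖(x : ℂ) * Complex.I‖ = |x| := by simp
  rcases le_total |x| 1 with h | h
  · have := Complex.norm_exp_sub_one_sub_id_le (x := (x : ℂ) * Complex.I) (by rwa [hn])
    rw [hn, sq_abs] at this
    unfold expChar
    rw [← hx]
    nlinarith [sq_nonneg x]
  · have h1 : ‖expChar m t - 1‖ ≤ |x| := by
      have := Real.norm_exp_I_mul_ofReal_sub_one_le (x := x)
      rwa [mul_comm] at this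
    have h2 := norm_sub_le (expChar m t - 1) ((x : ℂ) * Complex.I)
    rw [hn] at h2
    have : |x| ≤ x ^ 2 := by rw [← sq_abs]; nlinarith
    linarith

lemma tendsto_mul_expChar_sub (m u : ℝ) :
    Tendsto (fun N : ℕ => (N : ℂ) * (expChar m (u / √N) - 1 - (m * (u / √N) : ℝ) * Complex.I))
      atTop (𝓝 (-((m * u) ^ 2 / 2 : ℝ))) := by
  rw [← tendsto_sub_nhds_zero_iff]
  set x := m * u with hx
  have hsq : Tendsto (fun N : ℕ => √(N : ℝ)) atTop atTop :=
    Real.tendsto_sqrt_atTop.comp tendsto_natCast_atTop_atTop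
  refine squeeze_zero_norm' (a := fun N : ℕ => |x| ^ 3 / √N) ?_ (hsq.const_div_atTop _)
  filter_upwards [hsq.eventually_ge_atTop (max 1 |x|)] with N hN
  have hN1 : 1 ≤ √(N : ℝ) := (le_max_left _ _).trans hN
  have hN0 : 0 < √(N : ℝ) := by linarith
  have hNN : √(N : ℝ) ^ 2 = N := Real.sq_sqrt (Nat.cast_nonneg N)
  set z : ℂ := (m * (u / √N) : ℝ) * Complex.I with hz
  have hmu : m * (u / √N) = x / √N := by rw [hx]; ring
  have hzn : ‖z‖ = |x| / √N := by
    rw [hz, norm_mul, Complex.norm_I, mul_one, Complex.norm_real, hmu, Real.norm_eq_abs, abs_div,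
      abs_of_pos hN0]
  have hz1 : ‖z‖ ≤ 1 := by
    rw [hzn, div_le_one hN0]
    exact (le_max_right _ _).trans hN
  have h1 := Complex.exp_bound hz1 (n := 3) (by norm_num)
  have hz2 : (N : ℂ) * (z ^ 2 / 2) = -((x ^ 2 / 2 : ℝ) : ℂ) := by
    have hz2' : (N : ℝ) * ((x / √N) ^ 2 / 2) = x ^ 2 / 2 := by
      rw [div_pow, hNN]
      have : (N : ℝ) ≠ 0 := by rw [← hNN]; positivity
      field_simp
    rw [hz, hmu, mul_pow, Complex.I_sq, ← hz2']
    push_cast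
    ring
  rw [← hz2]
  have h2 : ((N : ℂ) * (expChar m (u / √N) - 1 - z) - N * (z ^ 2 / 2)) =
      N * (Complex.exp z - ∑ i ∈ range 3, z ^ i / (i.factorial : ℂ)) := by
    simp only [Finset.sum_range_succ, Finset.sum_range_zero, expChar, ← hz]
    norm_num [Nat.factorial]
    ring
  rw [h2, norm_mul, Complex.norm_natCast]
  calc (N : ℝ) * _ ≤ N * ‖z‖ ^ 3 := by
        refine mul_le_mul_of_nonneg_left (h1.trans ?_) (Nat.cast_nonneg _)
        have : ((Nat.succ 3 : ℕ) : ℝ) * ((Nat.factorial 3 : ℕ) * (3 : ℕ) : ℝ)⁻¹ ≤ 1 := by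
          norm_num [Nat.factorial]
        exact mul_le_of_le_one_right (by positivity) this
    _ = |x| ^ 3 / √N := by
        have h3 : (N : ℝ) * (|x| / √N) ^ 3 = √(N : ℝ) ^ 2 * (|x| / √N) ^ 3 := by rw [hNN]
        rw [hzn, h3]
        field_simp

lemma tendsto_charSeries_pow (hp : ∀ i, 0 ≤ p i) (hs : HasSum p 1)
    (hm : HasSum (fun i : ℕ => (i : ℝ) * p i) 1) {s2 : ℝ}
    (hv : HasSum (fun i : ℕ => ((i : ℝ) - 1) ^ 2 * p i) s2) (u : ℝ) :
    Tendsto (fun N : ℕ => (charSeries p (u / √N) * expChar (-1) (u / √N)) ^ N) atTop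
      (𝓝 (Complex.exp (-(s2 * u ^ 2 / 2 : ℝ)))) := by
  have hexp : ∀ t : ℝ, charSeries p t * expChar (-1) t - 1 =
      ∑' k : ℕ, (p k : ℂ) * (expChar (k - 1) t - 1 - ((k - 1 : ℝ) * t : ℝ) * Complex.I) := by
    intro t
    have hf : Summable fun k : ℕ => (p k : ℂ) * expChar k t := by
      refine Summable.of_norm ?_
      simp_rw [norm_ofReal_mul_expChar]
      exact hs.summable.abs
    have hsC : HasSum (fun k => (p k : ℂ)) 1 := by
      simpa using Complex.hasSum_ofReal.2 hs
    have hmC : HasSum (fun k : ℕ => (((k : ℝ) * p k - p k : ℝ) : ℂ)) 0 := by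
      have := Complex.hasSum_ofReal.2 (hm.sub hs)
      simpa using this
    have h1 := ((hf.hasSum.mul_right (expChar (-1) t)).sub hsC).sub
      ((hmC.mul_right (t : ℂ)).mul_right Complex.I)
    rw [zero_mul, zero_mul, sub_zero] at h1
    rw [charSeries, ← h1.tsum_eq]
    refine tsum_congr fun k => ?_
    rw [mul_assoc, ← expChar_add]
    push_cast
    ring_nf
  have hlim : Tendsto (fun N : ℕ => (N : ℂ) * (charSeries p (u / √N) * expChar (-1) (u / √N) - 1))
      atTop (𝓝 (-(s2 * u ^ 2 / 2 : ℝ))) := by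
    simp_rw [hexp, ← tsum_mul_left]
    have hg : (-(s2 * u ^ 2 / 2 : ℝ) : ℂ) =
        ∑' k : ℕ, (p k : ℂ) * (-((((k : ℝ) - 1) * u) ^ 2 / 2 : ℝ)) := by
      have := (Complex.hasSum_ofReal.2 ((hv.mul_right (u ^ 2 / 2)).neg)).tsum_eq
      push_cast at this ⊢
      rw [mul_div_assoc, ← this]
      exact tsum_congr fun k => by ring
    rw [hg]
    refine tendsto_tsum_of_dominated_convergence
      (bound := fun k : ℕ => 2 * u ^ 2 * (((k : ℝ) - 1) ^ 2 * p k)) (hv.summable.mul_left _) ?_ ?_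
    · intro k
      have := (tendsto_mul_expChar_sub ((k : ℝ) - 1) u).const_mul (p k : ℂ)
      refine this.congr fun N => ?_
      ring
    · filter_upwards [eventually_gt_atTop 0] with N hN k
      have hN' : (0 : ℝ) < N := by exact_mod_cast hN
      have hk := norm_expChar_sub_le ((k : ℝ) - 1) (u / √N)
      rw [norm_mul, norm_mul, Complex.norm_natCast, Complex.norm_real, Real.norm_eq_abs,
        abs_of_nonneg (hp k)]
      calc (N : ℝ) * (p k * _) ≤ N * (p k * (2 * (((k : ℝ) - 1) * (u / √N)) ^ 2)) := by
            gcongr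
            exact hp k
        _ = _ := by
            rw [mul_pow, div_pow, Real.sq_sqrt hN'.le]
            field_simp
  have := Complex.tendsto_one_add_pow_exp_of_tendsto hlim
  simpa using this

/-- The rescaled integrand of the Fourier inversion formula for `powCoeff p N (N - 1)`. -/
noncomputable def inversionIntegrand (p : ℕ → ℝ) (h N : ℕ) : ℝ → ℂ :=
  (Set.Ioc (-(Real.pi / h * √N)) (Real.pi / h * √N)).indicator fun u =>
    (charSeries p (u / √N) * expChar (-1) (u / √N)) ^ N * expChar 1 (u / √N)

lemma norm_inversionIntegrand_le {h N : ℕ} {c : ℝ}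
    (hc : ∀ t : ℝ, |t| ≤ Real.pi / h → ‖charSeries p t‖ ≤ Real.exp (-c * t ^ 2)) (u : ℝ) :
    ‖inversionIntegrand p h N u‖ ≤ Real.exp (-c * u ^ 2) := by
  rw [inversionIntegrand]
  by_cases hu : u ∈ Set.Ioc (-(Real.pi / h * √N)) (Real.pi / h * √N)
  · rw [Set.indicator_of_mem hu, norm_mul, norm_expChar, mul_one, norm_pow, norm_mul, norm_expChar,
      mul_one]
    have hN : 0 < √(N : ℝ) := by
      refine lt_of_le_of_ne (Real.sqrt_nonneg _) fun hN => ?_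
      rw [← hN] at hu
      simp only [mul_zero, neg_zero, Set.Ioc_self, Set.mem_empty_iff_false] at hu
    have hu' : |u / √N| ≤ Real.pi / h := by
      rw [abs_div, abs_of_pos hN, div_le_iff₀ hN]
      exact abs_le.2 ⟨hu.1.le, hu.2⟩
    calc ‖charSeries p (u / √N)‖ ^ N ≤ Real.exp (-c * (u / √N) ^ 2) ^ N := by
          gcongr
          exact hc _ hu'
      _ = Real.exp (-c * u ^ 2) := by
          rw [← Real.exp_nat_mul, div_pow, Real.sq_sqrt (Nat.cast_nonneg N)]
          have : (N : ℝ) ≠ 0 := (Real.sqrt_pos.1 hN).ne'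
          congr 1
          field_simp
  · rw [Set.indicator_of_notMem hu, norm_zero]
    positivity

lemma integral_inversionIntegrand (hp : ∀ i, 0 ≤ p i) (hs : Summable p) {h : ℕ} (hh : 0 < h)
    (hdvd : ∀ i, p i ≠ 0 → h ∣ i) {N : ℕ} (hN : 1 ≤ N) (hm : h ∣ N - 1) :
    ∫ u, inversionIntegrand p h N u = (√N * (2 * Real.pi / h * powCoeff p N (N - 1)) : ℝ) := by
  have hN0 : 0 < √(N : ℝ) := Real.sqrt_pos.2 (by exact_mod_cast hN)
  have hpi : 0 ≤ Real.pi / h * √N := by positivity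
  simp_rw [inversionIntegrand]
  rw [integral_indicator measurableSet_Ioc, ← intervalIntegral.integral_of_le (by linarith)]
  have h1 : ∀ t : ℝ, (charSeries p t * expChar (-1) t) ^ N * expChar 1 t =
      charSeries p t ^ N * expChar (-(N - 1 : ℕ)) t := by
    intro t
    have h2 : expChar (-1) t ^ N = expChar (-N) t := by
      rw [expChar, expChar, ← Complex.exp_nat_mul]
      congr 1
      push_cast
      ring
    rw [mul_pow, mul_assoc, h2, ← expChar_add, Nat.cast_sub hN]
    congr 2
    push_cast
    ring
  simp_rw [h1]
  rw [intervalIntegral.integral_comp_div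
    (fun t => charSeries p t ^ N * expChar (-(N - 1 : ℕ)) t) hN0.ne', neg_div,
    mul_div_cancel_right₀ _ hN0.ne', integral_charSeries_pow hp hs hh hdvd N hm, Complex.real_smul]
  push_cast
  ring

lemma tendsto_integral_inversionIntegrand (hp : ∀ i, 0 ≤ p i) (hs : HasSum p 1)
    (hm : HasSum (fun i : ℕ => (i : ℝ) * p i) 1) {s2 : ℝ}
    (hv : HasSum (fun i : ℕ => ((i : ℝ) - 1) ^ 2 * p i) s2) {h : ℕ} (hh : 0 < h)
    {c : ℝ} (hc0 : 0 < c)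
    (hc : ∀ t : ℝ, |t| ≤ Real.pi / h → ‖charSeries p t‖ ≤ Real.exp (-c * t ^ 2)) :
    Tendsto (fun N => ∫ u, inversionIntegrand p h N u) atTop (𝓝 (√(Real.pi / (s2 / 2)) : ℝ)) := by
  have hlim : ((√(Real.pi / (s2 / 2)) : ℝ) : ℂ) =
      ∫ u : ℝ, Complex.exp (-(s2 * u ^ 2 / 2 : ℝ)) := by
    rw [← integral_gaussian, ← integral_complex_ofReal]
    congr 1 with u
    push_cast
    congr 1
    ring
  rw [hlim]
  refine tendsto_integral_of_dominated_convergence (fun u => Real.exp (-c * u ^ 2)) ?_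
    (integrable_exp_neg_mul_sq hc0) (fun N => ae_of_all _ fun u => norm_inversionIntegrand_le hc u)
    (ae_of_all _ fun u => ?_)
  · intro N
    refine (Continuous.aestronglyMeasurable ?_).indicator measurableSet_Ioc
    have := continuous_charSeries hs.summable
    fun_prop
  · have hsq : Tendsto (fun N : ℕ => √(N : ℝ)) atTop atTop :=
      Real.tendsto_sqrt_atTop.comp tendsto_natCast_atTop_atTop
    have hE : Tendsto (fun N : ℕ => expChar 1 (u / √N)) atTop (𝓝 1) := by
      have h0 : Tendsto (fun N : ℕ => u / √(N : ℝ)) atTop (𝓝 0) := hsq.const_div_atTop u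
      have h1 : Continuous (expChar 1) := continuous_expChar 1
      have h2 := (h1.tendsto 0).comp h0
      simpa [expChar, Function.comp_def] using h2
    have h3 := (tendsto_charSeries_pow hp hs hm hv u).mul hE
    rw [mul_one] at h3
    refine h3.congr' ?_
    have hpi : 0 < Real.pi / h := by positivity
    filter_upwards [(hsq.const_mul_atTop hpi).eventually_gt_atTop |u|] with N hN
    rw [inversionIntegrand, Set.indicator_of_mem]
    rw [abs_lt] at hN
    exact ⟨hN.1, hN.2.le⟩

/-- The local limit theorem, as two-sided bounds at the point one step below the mean. -/
lemma local_limit_bounds (hp : ∀ i, 0 ≤ p i) (hs : HasSum p 1)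
    (hm : HasSum (fun i : ℕ => (i : ℝ) * p i) 1) {s2 : ℝ} (hs2 : 0 < s2)
    (hv : HasSum (fun i : ℕ => ((i : ℝ) - 1) ^ 2 * p i) s2) (h0 : p 0 ≠ 0) {k : ℕ} (hk0 : k ≠ 0)
    (hk : p k ≠ 0) :
    ∃ h : ℕ, 0 < h ∧ (∀ i, p i ≠ 0 → h ∣ i) ∧ ∃ c > 0, ∃ C > 0, ∃ N₀ : ℕ,
      (∀ N, 1 ≤ N → powCoeff p N (N - 1) ≤ C / √N) ∧
      ∀ N, 1 ≤ N → N₀ ≤ N → h ∣ N - 1 → c / √N ≤ powCoeff p N (N - 1) := by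
  obtain ⟨h, hh, hdvd, c, hc0, hc⟩ := exists_span hp hs h0 hk0 hk
  have hh' : (0 : ℝ) < h := by exact_mod_cast hh
  have hpi := Real.pi_pos
  have hlim := (tendsto_integral_inversionIntegrand hp hs hm hv hh hc0 hc).norm
  set L := √(Real.pi / (s2 / 2))
  have hL : 0 < L := Real.sqrt_pos.2 (by positivity)
  rw [Complex.norm_real, Real.norm_of_nonneg hL.le] at hlim
  obtain ⟨N₀, hN₀⟩ := eventually_atTop.1 (hlim.eventually_const_le (half_lt_self hL))
  have hnorm : ∀ N, 1 ≤ N → h ∣ N - 1 → ‖∫ u, inversionIntegrand p h N u‖ =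
      √N * (2 * Real.pi / h * powCoeff p N (N - 1)) := by
    intro N hN hd
    rw [integral_inversionIntegrand hp hs.summable hh hdvd hN hd, Complex.norm_real,
      Real.norm_of_nonneg]
    have := powCoeff_nonneg hp N (N - 1)
    positivity
  refine ⟨h, hh, hdvd, L / 2 / (2 * Real.pi / h), by positivity,
    √(Real.pi / c) / (2 * Real.pi / h), by positivity, N₀, ?_, ?_⟩
  · intro N hN
    have hN0 : 0 < √(N : ℝ) := Real.sqrt_pos.2 (by exact_mod_cast hN)
    by_cases hd : h ∣ N - 1
    · rw [le_div_iff₀ hN0, le_div_iff₀ (by positivity)]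
      calc _ = ‖∫ u, inversionIntegrand p h N u‖ := by rw [hnorm N hN hd]; ring
        _ ≤ ∫ u : ℝ, Real.exp (-c * u ^ 2) := norm_integral_le_of_norm_le
            (integrable_exp_neg_mul_sq hc0) (ae_of_all _ fun u => norm_inversionIntegrand_le hc u)
        _ = _ := integral_gaussian c
    · rw [powCoeff_eq_zero_of_not_dvd hdvd N hd]
      positivity
  · intro N hN hN' hd
    have hN0 : 0 < √(N : ℝ) := Real.sqrt_pos.2 (by exact_mod_cast hN)
    rw [div_le_iff₀ hN0, div_le_iff₀ (by positivity)]
    calc L / 2 ≤ _ := hN₀ N hN'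
      _ = _ := by rw [hnorm N hN hd]; ring

end LocalLimit

section TreeSeries

variable {p q : ℕ → ℝ}

lemma exists_pos_le_of_pos (f : ℕ → ℝ) (N : ℕ) : ∃ c > 0, ∀ n < N, 0 < f n → c ≤ f n := by
  induction N with
  | zero => exact ⟨1, one_pos, fun n hn => absurd hn n.not_lt_zero⟩
  | succ N ih =>
    obtain ⟨c, hc, h⟩ := ih
    by_cases hN : 0 < f N
    · refine ⟨min c (f N), lt_min hc hN, fun n hn hf => ?_⟩
      rcases Nat.lt_succ_iff_lt_or_eq.1 hn with hn | rfl
      · exact (min_le_left _ _).trans (h n hn hf)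
      · exact min_le_right _ _
    · refine ⟨c, hc, fun n hn hf => ?_⟩
      rcases Nat.lt_succ_iff_lt_or_eq.1 hn with hn | rfl
      · exact h n hn hf
      · exact absurd hf hN

/-- Two-sided `n ^ (-3/2)` bounds for the solution of the recursion of total tree weights. -/
lemma tree_series_bounds (hp : ∀ i, 0 ≤ p i) (hs : HasSum p 1)
    (hm : HasSum (fun i : ℕ => (i : ℝ) * p i) 1) {s2 : ℝ} (hs2 : 0 < s2)
    (hv : HasSum (fun i : ℕ => ((i : ℝ) - 1) ^ 2 * p i) s2) (h0 : p 0 ≠ 0) {k : ℕ} (hk0 : k ≠ 0)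
    (hk : p k ≠ 0) (hq0 : q 0 = 0)
    (hq : ∀ n, q (n + 1) = ∑ k ∈ range (n + 1), p k *
      ∑ s ∈ Finset.Nat.antidiagonalTuple k n, ∏ i, q (s i)) :
    ∃ h : ℕ, 0 < h ∧ (∀ i, p i ≠ 0 → h ∣ i) ∧ ∃ c > 0, ∃ C > 0, ∃ n₀ : ℕ,
      (∀ n : ℕ, 1 ≤ n → q n ≤ C / (n * √n)) ∧
      (∀ n : ℕ, 1 ≤ n → n₀ ≤ n → h ∣ n - 1 → c / (n * √n) ≤ q n) ∧
      ∀ n : ℕ, 1 ≤ n → 0 < q n → h ∣ n - 1 ∧ c / (n * √n) ≤ q n := by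
  obtain ⟨h, hh, hdvd, c, hc, C, hC, N₀, hU, hL⟩ := local_limit_bounds hp hs hm hs2 hv h0 hk0 hk
  have hqp : ∀ n : ℕ, 1 ≤ n → n * q n = powCoeff p n (n - 1) := by
    intro n hn
    obtain ⟨m, rfl⟩ := Nat.exists_eq_add_of_le' hn
    have := otter_dwass (p := p) hq0 (fun n => by
      rw [hq n]
      exact Finset.sum_congr rfl fun k _ => by rw [sum_antidiagonalTuple_prod]) m 1 (by omega)
    simpa using this
  obtain ⟨c₁, hc₁, hmin⟩ := exists_pos_le_of_pos (fun n => q n * (n * √n)) N₀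
  have hpos : ∀ n : ℕ, 1 ≤ n → (0 : ℝ) < n ∧ 0 < √(n : ℝ) := fun n hn => by
    have : (0 : ℝ) < n := by exact_mod_cast hn
    exact ⟨this, Real.sqrt_pos.2 this⟩
  have hlow : ∀ n : ℕ, 1 ≤ n → N₀ ≤ n → h ∣ n - 1 → c / (n * √n) ≤ q n := by
    intro n hn hn' hd
    obtain ⟨h1, h2⟩ := hpos n hn
    have := hL n hn hn' hd
    rw [← hqp n hn, div_le_iff₀ h2] at this
    rw [div_le_iff₀ (by positivity)]
    linarith
  have hle : ∀ n : ℕ, min c c₁ / (n * √n) ≤ c / (n * √n) := fun n => by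
    gcongr
    exact min_le_left _ _
  refine ⟨h, hh, hdvd, min c c₁, lt_min hc hc₁, C, hC, N₀, ?_, ?_, ?_⟩
  · intro n hn
    obtain ⟨h1, h2⟩ := hpos n hn
    have := hU n hn
    rw [← hqp n hn, le_div_iff₀ h2] at this
    rw [le_div_iff₀ (by positivity)]
    linarith
  · exact fun n hn hn' hd => (hle n).trans (hlow n hn hn' hd)
  · intro n hn hqn
    obtain ⟨h1, h2⟩ := hpos n hn
    have hd : h ∣ n - 1 := by
      by_contra hd
      have h3 := hqp n hn
      rw [powCoeff_eq_zero_of_not_dvd hdvd n hd] at h3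
      have : 0 < n * q n := by positivity
      linarith
    refine ⟨hd, ?_⟩
    rcases le_or_gt N₀ n with h3 | h3
    · exact (hle n).trans (hlow n hn h3 hd)
    · rw [div_le_iff₀ (by positivity)]
      exact (min_le_right _ _).trans (hmin n h3 (by positivity))

lemma sum_prod_le_mul_prod_compl {k n N : ℕ} (w : Fin k → ℕ → ℝ) (hw : ∀ a x, 0 ≤ w a x)
    (hn : n < N) (i : Fin k) {M : ℝ} (hM : ∀ x, w i x ≤ M) :
    ∑ s ∈ Finset.Nat.antidiagonalTuple k n, ∏ a, w a (s a) ≤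
      M * ∏ a ∈ ({i}ᶜ : Finset (Fin k)), ∑ x ∈ range N, w a x := by
  obtain ⟨k, rfl⟩ : ∃ k', k = k' + 1 := ⟨k - 1, by have := i.2; omega⟩
  have hM0 : 0 ≤ M := (hw i 0).trans (hM 0)
  rw [← Fin.image_succAbove_univ, Finset.prod_image (fun _ _ _ _ h => Fin.succAbove_right_injective h),
    Finset.prod_univ_sum, Finset.mul_sum]
  have hinj : Set.InjOn (fun s : Fin (k + 1) → ℕ => i.removeNth s)
      (Finset.Nat.antidiagonalTuple (k + 1) n) := by
    intro s hs t ht hst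
    rw [Finset.mem_coe, Finset.Nat.mem_antidiagonalTuple, Fin.sum_univ_succAbove _ i] at hs ht
    have hst' : ∀ a, s (i.succAbove a) = t (i.succAbove a) := fun a => congrFun hst a
    simp_rw [hst'] at hs
    funext a
    rcases eq_or_ne a i with rfl | ha
    · omega
    · obtain ⟨b, rfl⟩ := Fin.exists_succAbove_eq ha
      exact hst' b
  calc _ ≤ ∑ s ∈ Finset.Nat.antidiagonalTuple (k + 1) n,
        M * ∏ a, w (i.succAbove a) (i.removeNth s a) := by
        refine Finset.sum_le_sum fun s _ => ?_
        rw [Fin.prod_univ_succAbove _ i]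
        exact mul_le_mul_of_nonneg_right (hM _) (Finset.prod_nonneg fun a _ => hw _ _)
    _ = ∑ r ∈ (Finset.Nat.antidiagonalTuple (k + 1) n).image (fun s => i.removeNth s),
        M * ∏ a, w (i.succAbove a) (r a) := by
        rw [Finset.sum_image hinj]
    _ ≤ _ := by
        refine Finset.sum_le_sum_of_subset_of_nonneg ?_ fun r _ _ =>
          mul_nonneg hM0 (Finset.prod_nonneg fun a _ => hw _ _)
        intro r hr
        obtain ⟨s, hs, rfl⟩ := Finset.mem_image.1 hr
        rw [Finset.Nat.mem_antidiagonalTuple] at hs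
        rw [Fintype.mem_piFinset]
        intro a
        rw [mem_range]
        have : s (i.succAbove a) ≤ ∑ b, s b :=
          Finset.single_le_sum (f := s) (fun _ _ => Nat.zero_le _) (Finset.mem_univ _)
        simp only [Fin.removeNth]
        omega

lemma sum_range_tree_series_le_one (hp : ∀ i, 0 ≤ p i) (hs : HasSum p 1) (hqn : ∀ n, 0 ≤ q n)
    (hq0 : q 0 = 0)
    (hq : ∀ n, q (n + 1) = ∑ k ∈ range (n + 1), p k *
      ∑ s ∈ Finset.Nat.antidiagonalTuple k n, ∏ i, q (s i)) (n : ℕ) :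
    ∑ m ∈ range n, q m ≤ 1 := by
  induction n with
  | zero => simp
  | succ n ih =>
    rw [Finset.sum_range_succ', hq0, add_zero]
    have hS : ∀ k, ∑ m ∈ range n, ∑ s ∈ Finset.Nat.antidiagonalTuple k m, ∏ i, q (s i) ≤ 1 := by
      intro k
      rw [Finset.sum_sigma']
      have h1 : (∑ m ∈ range n, q m) ^ k ≤ 1 :=
        pow_le_one₀ (Finset.sum_nonneg fun _ _ => hqn _) ih
      refine le_trans ?_ h1
      have h2 : (∑ m ∈ range n, q m) ^ k = ∏ _i : Fin k, ∑ m ∈ range n, q m := by simp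
      rw [h2, Finset.prod_univ_sum]
      have hinj : Set.InjOn (fun x : (_ : ℕ) × (Fin k → ℕ) => x.2)
          ((range n).sigma fun m => Finset.Nat.antidiagonalTuple k m) := by
        rintro ⟨a, s⟩ ha ⟨b, t⟩ hb (rfl : s = t)
        simp only [coe_sigma, Set.mem_sigma_iff, mem_coe, mem_range,
          Finset.Nat.mem_antidiagonalTuple] at ha hb
        obtain rfl : a = b := ha.2.symm.trans hb.2
        rfl
      rw [← Finset.sum_image (f := fun s : Fin k → ℕ => ∏ i, q (s i)) hinj]
      refine Finset.sum_le_sum_of_subset_of_nonneg ?_ fun r _ _ => Finset.prod_nonneg fun _ _ => hqn _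
      intro r hr
      obtain ⟨⟨m, s⟩, hs, rfl⟩ := Finset.mem_image.1 hr
      simp only [Finset.mem_sigma, mem_range, Finset.Nat.mem_antidiagonalTuple] at hs
      rw [Fintype.mem_piFinset]
      intro a
      rw [mem_range]
      have : s a ≤ ∑ b, s b :=
        Finset.single_le_sum (f := s) (fun _ _ => Nat.zero_le _) (Finset.mem_univ _)
      dsimp only
      omega
    calc ∑ m ∈ range n, q (m + 1) ≤ ∑ m ∈ range n, ∑ k ∈ range n, p k *
          ∑ s ∈ Finset.Nat.antidiagonalTuple k m, ∏ i, q (s i) := by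
          refine Finset.sum_le_sum fun m hm => ?_
          rw [hq m]
          refine Finset.sum_le_sum_of_subset_of_nonneg ?_ fun k _ _ => mul_nonneg (hp k)
            (Finset.sum_nonneg fun s _ => Finset.prod_nonneg fun _ _ => hqn _)
          exact Finset.range_mono (by simpa using hm)
      _ = ∑ k ∈ range n, p k * ∑ m ∈ range n,
          ∑ s ∈ Finset.Nat.antidiagonalTuple k m, ∏ i, q (s i) := by
          rw [Finset.sum_comm]
          simp_rw [Finset.mul_sum]
      _ ≤ ∑ k ∈ range n, p k := Finset.sum_le_sum fun k _ => mul_le_of_le_one_right (hp k) (hS k)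
      _ ≤ 1 := by
          rw [← hs.tsum_eq]
          exact hs.summable.sum_le_tsum _ fun k _ => hp k

end TreeSeries

section TreeSeries

variable {q : ℕ → ℝ} {C : ℝ}

lemma sqrt_succ_pos_and_le {m : ℕ} (hm : 1 ≤ m) : 0 < √(m : ℝ) ∧ √(m : ℝ) ^ 2 = m ∧
    √((m + 1 : ℕ) : ℝ) ^ 2 = m + 1 ∧ √(m : ℝ) ≤ √((m + 1 : ℕ) : ℝ) ∧
    √((m + 1 : ℕ) : ℝ) ≤ 3 / 2 * √(m : ℝ) := by
  have hm' : (1 : ℝ) ≤ m := by exact_mod_cast hm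
  have h1 : √(m : ℝ) ^ 2 = m := Real.sq_sqrt (by positivity)
  have h2 : √((m + 1 : ℕ) : ℝ) ^ 2 = m + 1 := by
    rw [Real.sq_sqrt (by positivity)]
    push_cast
    ring
  refine ⟨Real.sqrt_pos.2 (by positivity), h1, h2, ?_, ?_⟩
  · exact Real.sqrt_le_sqrt (by push_cast; linarith)
  · refine le_of_sq_le_sq ?_ (by positivity)
    rw [mul_pow, h1, h2]
    linarith

lemma sum_range_mul_le_sqrt (hC : 0 ≤ C) (hU : ∀ n : ℕ, 1 ≤ n → q n ≤ C / (n * √n)) (N : ℕ) :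
    ∑ m ∈ range N, m * q m ≤ 3 * C * √N := by
  induction N with
  | zero => simp
  | succ N ih =>
    rw [Finset.sum_range_succ]
    have h2 : (N : ℝ) * q N ≤ 3 * C * (√(N + 1 : ℕ) - √N) := by
      rcases Nat.eq_zero_or_pos N with rfl | hN
      · simpa using hC
      · obtain ⟨hx, hxx, hyy, hxy, hyx⟩ := sqrt_succ_pos_and_le hN
        have hN' : (0 : ℝ) < N := by exact_mod_cast hN
        have h1 := hU N hN
        rw [le_div_iff₀ (by positivity), ← mul_assoc] at h1
        have h3 : 1 ≤ 3 * (√((N + 1 : ℕ) : ℝ) - √N) * √N := by nlinarith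
        rw [← mul_le_mul_iff_left₀ hx]
        calc (N : ℝ) * q N * √N = q N * N * √N := by ring
          _ ≤ C := h1
          _ ≤ C * (3 * (√((N + 1 : ℕ) : ℝ) - √N) * √N) := le_mul_of_one_le_right hC h3
          _ = _ := by ring
    linarith

lemma sum_range_tail_le (hC : 0 ≤ C) (hU : ∀ n : ℕ, 1 ≤ n → q n ≤ C / (n * √n)) {m : ℕ}
    (hm : 1 ≤ m) (N : ℕ) :
    ∑ x ∈ range N, (if m ≤ x then q x else 0) ≤ 4 * C / √m := by
  have hm0 : 0 < √(m : ℝ) := (sqrt_succ_pos_and_le hm).1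
  rcases le_total N m with h | h
  · rw [Finset.sum_eq_zero fun x hx => if_neg (by rw [mem_range] at hx; omega)]
    positivity
  · have key : ∑ x ∈ range N, (if m ≤ x then q x else 0) ≤ 4 * C * (1 / √m - 1 / √N) := by
      induction N, h using Nat.le_induction with
      | base =>
        rw [Finset.sum_eq_zero fun x hx => if_neg (by rw [mem_range] at hx; omega), sub_self,
          mul_zero]
      | succ N hN ih =>
        obtain ⟨hx, hxx, hyy, hxy, hyx⟩ := sqrt_succ_pos_and_le (hm.trans hN)
        rw [Finset.sum_range_succ, if_pos hN]
        have h1 := hU N (hm.trans hN)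
        set a := √(N : ℝ)
        set b := √((N + 1 : ℕ) : ℝ)
        have hb : 0 < b := hx.trans_le hxy
        have h2 : 1 / (N * a) ≤ 4 * (1 / a - 1 / b) := by
          have hab : 1 / a - 1 / b = 1 / (a * b * (a + b)) := by
            have : (b - a) * (a + b) = 1 := by linarith
            field_simp
            linarith
          rw [hab, mul_one_div, div_le_div_iff₀ (by rw [← hxx]; positivity) (by positivity),
            ← hxx]
          nlinarith [mul_le_mul_of_nonneg_left hyx (mul_pos hx hx).le, mul_pos hx hx,
            mul_le_mul hyx hyx hb.le (by positivity)]
        have h3 : C / (N * a) ≤ C * (4 * (1 / a - 1 / b)) := by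
          rw [div_eq_mul_one_div]
          exact mul_le_mul_of_nonneg_left h2 hC
        linarith
    refine key.trans ?_
    rw [mul_div_assoc, div_eq_mul_one_div C, mul_assoc]
    have : 0 ≤ 1 / √(N : ℝ) := by positivity
    gcongr
    rw [div_eq_mul_one_div]
    simp

lemma sum_range_mul_tail_le (hC : 0 ≤ C) (hqn : ∀ n, 0 ≤ q n)
    (hU : ∀ n : ℕ, 1 ≤ n → q n ≤ C / (n * √n)) {N : ℕ} (hN : 1 ≤ N) :
    ∑ m ∈ range N, m * q m * ∑ x ∈ range N, (if m ≤ x then q x else 0) ≤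
      4 * C ^ 2 * (1 + Real.log N) := by
  obtain ⟨M, rfl⟩ := Nat.exists_eq_add_of_le' hN
  have h1 : ∀ m ∈ range M, ((m + 1 : ℕ) : ℝ) * q (m + 1) *
      ∑ x ∈ range (M + 1), (if m + 1 ≤ x then q x else 0) ≤ 4 * C ^ 2 * ((m + 1 : ℕ) : ℝ)⁻¹ := by
    intro m _
    have hm : 1 ≤ m + 1 := by omega
    obtain ⟨hx, hxx, -⟩ := sqrt_succ_pos_and_le hm
    have hm' : (0 : ℝ) < (m + 1 : ℕ) := by positivity
    have h2 : ((m + 1 : ℕ) : ℝ) * q (m + 1) ≤ C / √(m + 1 : ℕ) := by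
      have := hU (m + 1) hm
      rw [le_div_iff₀ (by positivity)] at this ⊢
      linarith
    calc _ ≤ C / √((m + 1 : ℕ) : ℝ) * (4 * C / √((m + 1 : ℕ) : ℝ)) := by
          refine mul_le_mul h2 (sum_range_tail_le hC hU hm _) ?_ (by positivity)
          exact Finset.sum_nonneg fun x _ => by split_ifs; exacts [hqn x, le_rfl]
      _ = _ := by
          rw [div_mul_div_comm, ← sq, hxx]
          field_simp
  rw [Finset.sum_range_succ']
  simp only [Nat.cast_zero, zero_mul, add_zero]
  refine (Finset.sum_le_sum h1).trans ?_
  rw [← Finset.mul_sum]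
  refine mul_le_mul_of_nonneg_left ?_ (by positivity)
  have h3 := harmonic_le_one_add_log M
  rw [harmonic] at h3
  push_cast at h3 ⊢
  refine h3.trans ?_
  rcases Nat.eq_zero_or_pos M with rfl | hM
  · simp
  · gcongr
    linarith

/-- `q x` is small when `x` is at least a `k`-th of `n`. -/
lemma ite_le_of_le_mul (hC : 0 ≤ C) (hU : ∀ n : ℕ, 1 ≤ n → q n ≤ C / (n * √n)) {k n : ℕ}
    (hn : 1 ≤ n) (x : ℕ) :
    (if n ≤ k * x then q x else 0) ≤ 4 * C * k ^ 2 / ((n + 1 : ℕ) * √(n + 1 : ℕ)) := by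
  split_ifs with h
  · have hkx : 0 < k * x := by omega
    have hk : 0 < k := Nat.pos_of_mul_pos_right hkx
    have hx : 0 < x := Nat.pos_of_mul_pos_left hkx
    have hk' : (1 : ℝ) ≤ k := by exact_mod_cast hk
    have hx' : (0 : ℝ) < x := by exact_mod_cast hx
    have hsx : 0 < √(x : ℝ) := Real.sqrt_pos.2 hx'
    have h1 : ((n + 1 : ℕ) : ℝ) ≤ 2 * k * x := by
      have : n + 1 ≤ 2 * k * x := by nlinarith
      exact_mod_cast this
    have h2 : √((n + 1 : ℕ) : ℝ) ≤ 2 * k * √x := by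
      refine Real.sqrt_le_iff.2 ⟨by positivity, h1.trans ?_⟩
      rw [mul_pow, Real.sq_sqrt hx'.le]
      nlinarith
    have h3 : ((n + 1 : ℕ) : ℝ) * √((n + 1 : ℕ) : ℝ) ≤ 4 * k ^ 2 * (x * √x) := by
      calc _ ≤ (2 * k * x) * (2 * k * √(x : ℝ)) := by gcongr
        _ = _ := by ring
    refine (hU x hx).trans ?_
    rw [div_le_div_iff₀ (by positivity) (by positivity)]
    nlinarith [mul_le_mul_of_nonneg_left h3 hC]
  · positivity

end TreeSeries

section TreeSeries

variable {q : ℕ → ℝ} {C : ℝ}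

/-- The total size of pairs in which the first entry is at least the average. -/
noncomputable def pairLoss (k n : ℕ) (s : Fin k → ℕ) : ℝ :=
  ∑ i, ∑ j, if i ≠ j ∧ n ≤ k * s i then (s j : ℝ) else 0

/-- The total size of the smaller of two entries accompanied by an entry which is at least the
average. -/
noncomputable def tripleLoss (k n : ℕ) (s : Fin k → ℕ) : ℝ :=
  ∑ i, ∑ j, ∑ l, if i ≠ j ∧ i ≠ l ∧ j ≠ l ∧ n ≤ k * s i ∧ s l ≤ s j then (s l : ℝ) else 0

lemma prod_compl_le {k : ℕ} {G : Fin k → ℝ} (hG : ∀ a, 0 ≤ G a) {i j : Fin k} (hij : i ≠ j)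
    (h1 : ∀ a, a ≠ i → a ≠ j → G a ≤ 1) : ∏ a ∈ ({i}ᶜ : Finset (Fin k)), G a ≤ G j := by
  rw [← Finset.mul_prod_erase _ _ (a := j) (by simpa using hij.symm)]
  refine mul_le_of_le_one_right (hG j) (Finset.prod_le_one (fun a _ => hG a) fun a ha => ?_)
  simp only [mem_erase, mem_compl, mem_singleton] at ha
  exact h1 a ha.2 ha.1

lemma prod_compl_le_mul {k : ℕ} {G : Fin k → ℝ} (hG : ∀ a, 0 ≤ G a) {i j l : Fin k} (hij : i ≠ j)
    (hil : i ≠ l) (hjl : j ≠ l) (h1 : ∀ a, a ≠ i → a ≠ j → a ≠ l → G a ≤ 1) :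
    ∏ a ∈ ({i}ᶜ : Finset (Fin k)), G a ≤ G j * G l := by
  rw [← Finset.mul_prod_erase _ _ (a := j) (by simpa using hij.symm),
    ← Finset.mul_prod_erase _ _ (a := l) (by simpa using ⟨hjl.symm, hil.symm⟩)]
  refine mul_le_mul_of_nonneg_left (mul_le_of_le_one_right (hG l)
    (Finset.prod_le_one (fun a _ => hG a) fun a ha => ?_)) (hG j)
  simp only [mem_erase, mem_compl, mem_singleton] at ha
  exact h1 a ha.2.2 ha.2.1 ha.1

lemma sum_prod_mul_pairLoss_le (hC : 0 ≤ C) (hqn : ∀ n, 0 ≤ q n)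
    (hU : ∀ n : ℕ, 1 ≤ n → q n ≤ C / (n * √n)) (hQ : ∀ n, ∑ m ∈ range n, q m ≤ 1) {n : ℕ}
    (hn : 1 ≤ n) (k : ℕ) :
    ∑ s ∈ Finset.Nat.antidiagonalTuple k n, (∏ i, q (s i)) * pairLoss k n s ≤
      12 * C ^ 2 / (n + 1 : ℕ) * k ^ 4 := by
  set M := 4 * C * k ^ 2 / (((n + 1 : ℕ) : ℝ) * √((n + 1 : ℕ) : ℝ)) with hM
  have hM0 : 0 ≤ M := by positivity
  have hS : 0 < √((n + 1 : ℕ) : ℝ) := by positivity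
  have key : ∀ i j : Fin k, ∑ s ∈ Finset.Nat.antidiagonalTuple k n, (∏ i, q (s i)) *
      (if i ≠ j ∧ n ≤ k * s i then (s j : ℝ) else 0) ≤ M * (3 * C * √((n + 1 : ℕ) : ℝ)) := by
    intro i j
    by_cases hij : i = j
    · simp only [hij, ne_eq, not_true, false_and, if_false, mul_zero, Finset.sum_const_zero]
      positivity
    set w : Fin k → ℕ → ℝ := fun a x => q x * (if a = i then (if n ≤ k * x then 1 else 0) else 1) *
      (if a = j then (x : ℝ) else 1) with hw
    have hw0 : ∀ a x, 0 ≤ w a x := fun a x => by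
      refine mul_nonneg (mul_nonneg (hqn x) ?_) ?_
      · split_ifs <;> norm_num
      · split_ifs
        · positivity
        · exact zero_le_one
    have h1 : ∀ s : Fin k → ℕ, (∏ i, q (s i)) * (if i ≠ j ∧ n ≤ k * s i then (s j : ℝ) else 0) =
        ∏ a, w a (s a) := by
      intro s
      simp only [hw, Finset.prod_mul_distrib, Finset.prod_ite_eq', mem_univ, if_true]
      by_cases h : n ≤ k * s i <;> simp [h, hij]
    simp_rw [h1]
    refine (sum_prod_le_mul_prod_compl w hw0 n.lt_succ_self i (M := M) fun x => ?_).trans ?_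
    · have := ite_le_of_le_mul hC hU (k := k) hn x
      refine le_of_eq_of_le ?_ this
      simp [hw, hij]
    · refine mul_le_mul_of_nonneg_left ?_ hM0
      refine (prod_compl_le (fun a => Finset.sum_nonneg fun x _ => hw0 a x) hij ?_).trans ?_
      · intro a hai haj
        simpa [hw, hai, haj] using hQ (n + 1)
      · refine le_trans (le_of_eq ?_) (sum_range_mul_le_sqrt hC hU (n + 1))
        exact Finset.sum_congr rfl fun x _ => by simp [hw, Ne.symm hij, mul_comm]
  calc _ = ∑ i : Fin k, ∑ j : Fin k, ∑ s ∈ Finset.Nat.antidiagonalTuple k n, (∏ i, q (s i)) *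
        (if i ≠ j ∧ n ≤ k * s i then (s j : ℝ) else 0) := by
        simp_rw [pairLoss, Finset.mul_sum]
        rw [Finset.sum_comm]
        exact Finset.sum_congr rfl fun i _ => Finset.sum_comm
    _ ≤ ∑ _i : Fin k, ∑ _j : Fin k, M * (3 * C * √((n + 1 : ℕ) : ℝ)) :=
        Finset.sum_le_sum fun i _ => Finset.sum_le_sum fun j _ => key i j
    _ = _ := by
        simp only [Finset.sum_const, Finset.card_univ, Fintype.card_fin, nsmul_eq_mul, hM]
        field_simp
        ring

lemma sum_prod_mul_tripleLoss_le (hC : 0 ≤ C) (hqn : ∀ n, 0 ≤ q n)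
    (hU : ∀ n : ℕ, 1 ≤ n → q n ≤ C / (n * √n)) (hQ : ∀ n, ∑ m ∈ range n, q m ≤ 1) {n : ℕ}
    (hn : 1 ≤ n) (k : ℕ) :
    ∑ s ∈ Finset.Nat.antidiagonalTuple k n, (∏ i, q (s i)) * tripleLoss k n s ≤
      16 * C ^ 3 * (1 + Real.log (n + 1 : ℕ)) / ((n + 1 : ℕ) * √(n + 1 : ℕ)) * k ^ 5 := by
  set M := 4 * C * k ^ 2 / (((n + 1 : ℕ) : ℝ) * √((n + 1 : ℕ) : ℝ)) with hM
  have hM0 : 0 ≤ M := by positivity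
  have hS : 0 < √((n + 1 : ℕ) : ℝ) := by positivity
  have hlog : 0 ≤ Real.log (n + 1 : ℕ) := Real.log_natCast_nonneg _
  have key : ∀ i j l : Fin k, ∑ s ∈ Finset.Nat.antidiagonalTuple k n, (∏ i, q (s i)) *
      (if i ≠ j ∧ i ≠ l ∧ j ≠ l ∧ n ≤ k * s i ∧ s l ≤ s j then (s l : ℝ) else 0) ≤
        M * (4 * C ^ 2 * (1 + Real.log (n + 1 : ℕ))) := by
    intro i j l
    by_cases hne : i ≠ j ∧ i ≠ l ∧ j ≠ l
    swap
    · have : ∀ s : Fin k → ℕ, ¬(i ≠ j ∧ i ≠ l ∧ j ≠ l ∧ n ≤ k * s i ∧ s l ≤ s j) :=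
        fun s h => hne ⟨h.1, h.2.1, h.2.2.1⟩
      simp only [this, if_false, mul_zero, Finset.sum_const_zero]
      positivity
    obtain ⟨hij, hil, hjl⟩ := hne
    set w : ℕ → Fin k → ℕ → ℝ := fun m a x =>
      q x * (if a = i then (if n ≤ k * x then 1 else 0) else 1) *
      (if a = j then (if m ≤ x then 1 else 0) else 1) *
      (if a = l then (if x = m then (m : ℝ) else 0) else 1) with hw
    have hw0 : ∀ m a x, 0 ≤ w m a x := fun m a x => by
      refine mul_nonneg (mul_nonneg (mul_nonneg (hqn x) ?_) ?_) ?_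
      · split_ifs <;> norm_num
      · split_ifs <;> norm_num
      · split_ifs
        · positivity
        · exact le_rfl
        · exact zero_le_one
    have h1 : ∀ s ∈ Finset.Nat.antidiagonalTuple k n, (∏ i, q (s i)) *
        (if i ≠ j ∧ i ≠ l ∧ j ≠ l ∧ n ≤ k * s i ∧ s l ≤ s j then (s l : ℝ) else 0) =
        ∑ m ∈ range (n + 1), ∏ a, w m a (s a) := by
      intro s hs
      have hsl : s l ∈ range (n + 1) := by
        rw [Finset.Nat.mem_antidiagonalTuple] at hs
        have : s l ≤ ∑ b, s b :=
          Finset.single_le_sum (f := s) (fun _ _ => Nat.zero_le _) (Finset.mem_univ _)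
        rw [mem_range]
        omega
      simp only [hw, Finset.prod_mul_distrib, Finset.prod_ite_eq', mem_univ, if_true]
      simp_rw [mul_ite, mul_zero]
      rw [Finset.sum_ite_eq, if_pos hsl]
      by_cases h : n ≤ k * s i <;> by_cases h' : s l ≤ s j <;> simp [h, h', hij, hil, hjl]
    rw [Finset.sum_congr rfl h1, Finset.sum_comm]
    have h2 : ∀ m ∈ range (n + 1), ∑ s ∈ Finset.Nat.antidiagonalTuple k n, ∏ a, w m a (s a) ≤
        M * (m * q m * ∑ x ∈ range (n + 1), (if m ≤ x then q x else 0)) := by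
      intro m hm
      refine (sum_prod_le_mul_prod_compl (w m) (hw0 m) n.lt_succ_self i (M := M)
        fun x => ?_).trans ?_
      · have := ite_le_of_le_mul hC hU (k := k) hn x
        refine le_of_eq_of_le ?_ this
        simp [hw, hij, hil]
      · refine mul_le_mul_of_nonneg_left ?_ hM0
        refine (prod_compl_le_mul (fun a => Finset.sum_nonneg fun x _ => hw0 m a x) hij hil hjl
          ?_).trans (le_of_eq ?_)
        · intro a hai haj hal
          simpa [hw, hai, haj, hal] using hQ (n + 1)
        · have hj : ∑ x ∈ range (n + 1), w m j x =
              ∑ x ∈ range (n + 1), (if m ≤ x then q x else 0) :=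
            Finset.sum_congr rfl fun x _ => by simp [hw, hij.symm, hjl]
          have hl : ∑ x ∈ range (n + 1), w m l x = m * q m := by
            have : ∀ x, w m l x = if x = m then m * q m else 0 := fun x => by
              by_cases hx : x = m <;> simp [hw, hil.symm, hjl.symm, hx, mul_comm]
            simp_rw [this]
            rw [Finset.sum_ite_eq', if_pos hm]
          rw [hj, hl, mul_comm]
    refine (Finset.sum_le_sum h2).trans ?_
    rw [← Finset.mul_sum]
    exact mul_le_mul_of_nonneg_left (sum_range_mul_tail_le hC hqn hU (by omega)) hM0
  calc _ = ∑ i : Fin k, ∑ j : Fin k, ∑ l : Fin k, ∑ s ∈ Finset.Nat.antidiagonalTuple k n,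
        (∏ i, q (s i)) *
        (if i ≠ j ∧ i ≠ l ∧ j ≠ l ∧ n ≤ k * s i ∧ s l ≤ s j then (s l : ℝ) else 0) := by
        simp_rw [tripleLoss, Finset.mul_sum]
        rw [Finset.sum_comm]
        refine Finset.sum_congr rfl fun i _ => ?_
        rw [Finset.sum_comm]
        exact Finset.sum_congr rfl fun j _ => Finset.sum_comm
    _ ≤ ∑ _i : Fin k, ∑ _j : Fin k, ∑ _l : Fin k, M * (4 * C ^ 2 * (1 + Real.log (n + 1 : ℕ))) :=
        Finset.sum_le_sum fun i _ => Finset.sum_le_sum fun j _ => Finset.sum_le_sum fun l _ =>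
          key i j l
    _ = _ := by
        simp only [Finset.sum_const, Finset.card_univ, Fintype.card_fin, nsmul_eq_mul, hM]
        field_simp
        ring

end TreeSeries

section TreeSeries

variable {p q : ℕ → ℝ} {c C : ℝ}

lemma sum_mul_sum_prod_mul_pairLoss_le (hp : ∀ i, 0 ≤ p i)
    (h5 : Summable fun i : ℕ => (i : ℝ) ^ 5 * p i) (hC : 0 ≤ C) (hc : 0 < c) (hqn : ∀ n, 0 ≤ q n)
    (hU : ∀ n : ℕ, 1 ≤ n → q n ≤ C / (n * √n)) (hQ : ∀ n, ∑ m ∈ range n, q m ≤ 1) {n : ℕ}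
    (hn : 1 ≤ n) (hL : c / ((n + 1 : ℕ) * √(n + 1 : ℕ)) ≤ q (n + 1)) :
    ∑ k ∈ range (n + 1), p k * ∑ s ∈ Finset.Nat.antidiagonalTuple k n,
        (∏ i, q (s i)) * pairLoss k n s ≤
      12 * C ^ 2 * (∑' i : ℕ, (i : ℝ) ^ 5 * p i) / c * (q (n + 1) * √(n + 1 : ℕ)) := by
  have hS : 0 < √((n + 1 : ℕ) : ℝ) := by positivity
  have hM : 0 ≤ ∑' i : ℕ, (i : ℝ) ^ 5 * p i := tsum_nonneg fun i => mul_nonneg (by positivity) (hp i)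
  calc _ ≤ ∑ k ∈ range (n + 1), 12 * C ^ 2 / (n + 1 : ℕ) * ((k : ℝ) ^ 5 * p k) := by
        refine Finset.sum_le_sum fun k _ => ?_
        have h1 := mul_le_mul_of_nonneg_left (sum_prod_mul_pairLoss_le hC hqn hU hQ hn k) (hp k)
        have h2 : (k : ℝ) ^ 4 ≤ (k : ℝ) ^ 5 := by
          rcases Nat.eq_zero_or_pos k with rfl | hk
          · norm_num
          · exact pow_le_pow_right₀ (by exact_mod_cast hk) (by norm_num)
        have h3 := mul_le_mul_of_nonneg_left h2
          (mul_nonneg (hp k) (by positivity : 0 ≤ 12 * C ^ 2 / ((n + 1 : ℕ) : ℝ)))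
        linarith
    _ ≤ 12 * C ^ 2 / (n + 1 : ℕ) * ∑' i : ℕ, (i : ℝ) ^ 5 * p i := by
        rw [← Finset.mul_sum]
        refine mul_le_mul_of_nonneg_left ?_ (by positivity)
        exact h5.sum_le_tsum _ fun i _ => mul_nonneg (by positivity) (hp i)
    _ = 12 * C ^ 2 * (∑' i : ℕ, (i : ℝ) ^ 5 * p i) / c *
        (c / ((n + 1 : ℕ) * √(n + 1 : ℕ)) * √(n + 1 : ℕ)) := by
        field_simp
    _ ≤ _ := by gcongr

lemma sum_mul_sum_prod_mul_tripleLoss_le (hp : ∀ i, 0 ≤ p i)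
    (h5 : Summable fun i : ℕ => (i : ℝ) ^ 5 * p i) (hC : 0 ≤ C) (hc : 0 < c) (hqn : ∀ n, 0 ≤ q n)
    (hU : ∀ n : ℕ, 1 ≤ n → q n ≤ C / (n * √n)) (hQ : ∀ n, ∑ m ∈ range n, q m ≤ 1) {n : ℕ}
    (hn : 1 ≤ n) (hL : c / ((n + 1 : ℕ) * √(n + 1 : ℕ)) ≤ q (n + 1)) :
    ∑ k ∈ range (n + 1), p k * ∑ s ∈ Finset.Nat.antidiagonalTuple k n,
        (∏ i, q (s i)) * tripleLoss k n s ≤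
      16 * C ^ 3 * (∑' i : ℕ, (i : ℝ) ^ 5 * p i) / c *
        (q (n + 1) * (1 + Real.log (n + 1 : ℕ))) := by
  have hS : 0 < √((n + 1 : ℕ) : ℝ) := by positivity
  have hlog : 0 ≤ Real.log (n + 1 : ℕ) := Real.log_natCast_nonneg _
  have hM : 0 ≤ ∑' i : ℕ, (i : ℝ) ^ 5 * p i := tsum_nonneg fun i => mul_nonneg (by positivity) (hp i)
  calc _ ≤ ∑ k ∈ range (n + 1), 16 * C ^ 3 * (1 + Real.log (n + 1 : ℕ)) /
          ((n + 1 : ℕ) * √(n + 1 : ℕ)) * ((k : ℝ) ^ 5 * p k) := by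
        refine Finset.sum_le_sum fun k _ => ?_
        have h1 := mul_le_mul_of_nonneg_left (sum_prod_mul_tripleLoss_le hC hqn hU hQ hn k) (hp k)
        linarith
    _ ≤ 16 * C ^ 3 * (1 + Real.log (n + 1 : ℕ)) / ((n + 1 : ℕ) * √(n + 1 : ℕ)) *
          ∑' i : ℕ, (i : ℝ) ^ 5 * p i := by
        rw [← Finset.mul_sum]
        refine mul_le_mul_of_nonneg_left ?_ (by positivity)
        exact h5.sum_le_tsum _ fun i _ => mul_nonneg (by positivity) (hp i)
    _ = 16 * C ^ 3 * (∑' i : ℕ, (i : ℝ) ^ 5 * p i) / c *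
        (c / ((n + 1 : ℕ) * √(n + 1 : ℕ)) * (1 + Real.log (n + 1 : ℕ))) := by
        field_simp
    _ ≤ _ := by gcongr

/-- The square root of the smaller of the first two entries. -/
noncomputable def pairGain (k : ℕ) (s : Fin k → ℕ) : ℝ :=
  if h : 2 ≤ k then √((min (s ⟨0, by omega⟩) (s ⟨1, by omega⟩) : ℕ) : ℝ) else 0

lemma pairGain_nonneg (k : ℕ) (s : Fin k → ℕ) : 0 ≤ pairGain k s := by
  unfold pairGain
  split_ifs
  · positivity
  · exact le_rfl

lemma log_sub_le_sum_Ico (a : ℕ) {b n : ℕ} (hb : 1 ≤ b) (hn : 1 ≤ n) :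
    Real.log n - (Real.log b + ∑ i ∈ range a, ((i : ℝ) + 1)⁻¹) ≤
      ∑ i ∈ Finset.Ico a (n / b), ((i : ℝ) + 1)⁻¹ := by
  have hb' : (0 : ℝ) < b := by exact_mod_cast hb
  have hn' : (0 : ℝ) < n := by exact_mod_cast hn
  have h1 : Real.log n ≤ Real.log b + Real.log ((n / b : ℕ) + 1) := by
    rw [← Real.log_mul hb'.ne' (by positivity)]
    refine Real.log_le_log hn' ?_
    exact_mod_cast (Nat.lt_mul_div_succ n hb).le
  have h2 := log_add_one_le_harmonic (n / b)
  rw [harmonic] at h2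
  push_cast at h1 h2
  have h3 : ∑ i ∈ range (n / b), ((i : ℝ) + 1)⁻¹ ≤
      ∑ i ∈ range a, ((i : ℝ) + 1)⁻¹ + ∑ i ∈ Finset.Ico a (n / b), ((i : ℝ) + 1)⁻¹ := by
    rcases le_total a (n / b) with h | h
    · rw [Finset.sum_range_add_sum_Ico _ h]
    · rw [Finset.Ico_eq_empty_of_le h, Finset.sum_empty, add_zero]
      exact Finset.sum_le_sum_of_subset_of_nonneg (Finset.range_mono h)
        fun i _ _ => by positivity
  linarith

lemma sum_prod_mul_pairGain_ge {r h n n₀ : ℕ} (hh : 0 < h) (hr : h ∣ r + 2)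
    (hc : 0 < c) (hqn : ∀ n, 0 ≤ q n)
    (hL : ∀ n : ℕ, 1 ≤ n → n₀ ≤ n → h ∣ n - 1 → c / (n * √n) ≤ q n) (hd : h ∣ n)
    (hn : 4 * (n₀ + r + 2) ≤ n + 1) :
    q 1 ^ r * c ^ 2 / h / ((n + 1 : ℕ) * √(n + 1 : ℕ)) *
        ∑ i ∈ Finset.Ico n₀ ((n + 1) / (4 * h)), ((i : ℝ) + 1)⁻¹ ≤
      ∑ s ∈ Finset.Nat.antidiagonalTuple (r + 2) n, (∏ i, q (s i)) * pairGain (r + 2) s := by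
  set S : ℕ → Fin (r + 2) → ℕ := fun i =>
    Fin.cons (n - (1 + h * i) - r) (Fin.cons (1 + h * i) fun _ => 1) with hS
  have hbound : ∀ i ∈ Finset.Ico n₀ ((n + 1) / (4 * h)), 4 * (1 + h * i) ≤ n + 1 := by
    intro i hi
    rw [Finset.mem_Ico] at hi
    have h1 : (i + 1) * (4 * h) ≤ n + 1 := (Nat.le_div_iff_mul_le (by omega)).1 hi.2
    nlinarith
  have hinj : Set.InjOn S (Finset.Ico n₀ ((n + 1) / (4 * h))) := by
    intro i _ j _ hij
    have h1 : 1 + h * i = 1 + h * j := congrFun hij 1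
    exact Nat.eq_of_mul_eq_mul_left hh (by omega)
  calc _ ≤ ∑ i ∈ Finset.Ico n₀ ((n + 1) / (4 * h)),
        (∏ a, q (S i a)) * pairGain (r + 2) (S i) := by
        rw [Finset.mul_sum]
        refine Finset.sum_le_sum fun i hi => ?_
        have hb := hbound i hi
        rw [Finset.mem_Ico] at hi
        have hii : i ≤ h * i := Nat.le_mul_of_pos_left i hh
        set j := 1 + h * i with hj
        set m := n - j - r with hm
        have hjm : j ≤ m := by omega
        have hprod : ∏ a, q (S i a) = q m * (q j * q 1 ^ r) := by
          simp [hS, Fin.prod_univ_succ, ← hj, ← hm]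
        have hgain : pairGain (r + 2) (S i) = √(j : ℝ) := by
          rw [pairGain, dif_pos (by omega)]
          have h1 : S i ⟨1, by omega⟩ = j := rfl
          have h0 : S i ⟨0, by omega⟩ = m := rfl
          rw [h0, h1, min_eq_right hjm]
        have hj0 : (0 : ℝ) < j := by
          have : 0 < j := by omega
          exact_mod_cast this
        have hm0 : (0 : ℝ) < m := by
          have : 0 < m := by omega
          exact_mod_cast this
        have hsj : 0 < √(j : ℝ) := Real.sqrt_pos.2 hj0
        have hsm : 0 < √(m : ℝ) := Real.sqrt_pos.2 hm0
        have hqj : c / h * ((i : ℝ) + 1)⁻¹ ≤ q j * √j := by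
          have h1 := hL j (by omega) (by omega) (by simp [hj])
          rw [div_le_iff₀ (by positivity)] at h1
          have hh' : (1 : ℝ) ≤ h := by exact_mod_cast hh
          have h2 : (j : ℝ) ≤ h * ((i : ℝ) + 1) := by
            rw [hj]
            push_cast
            nlinarith
          rw [← div_eq_mul_inv, div_div, div_le_iff₀ (by positivity)]
          calc c ≤ q j * √j * j := by linarith
            _ ≤ _ := by
              refine mul_le_mul_of_nonneg_left h2 (mul_nonneg (hqn j) hsj.le)
        have hqm : c / ((n + 1 : ℕ) * √(n + 1 : ℕ)) ≤ q m := by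
          refine le_trans ?_ (hL m (by omega) (by omega) ?_)
          · have h1 : (m : ℝ) ≤ (n + 1 : ℕ) := by
              have : m ≤ n + 1 := by omega
              exact_mod_cast this
            gcongr
          · have h1 : m - 1 = n - (h * i + (r + 2)) := by omega
            rw [h1]
            exact Nat.dvd_sub hd (Dvd.dvd.add (Dvd.intro _ rfl) hr)
        rw [hprod, hgain]
        calc _ = q 1 ^ r * (c / ((n + 1 : ℕ) * √(n + 1 : ℕ)) * (c / h * ((i : ℝ) + 1)⁻¹)) := by
              ring
          _ ≤ q 1 ^ r * (q m * (q j * √j)) := by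
              refine mul_le_mul_of_nonneg_left ?_ (pow_nonneg (hqn 1) r)
              exact mul_le_mul hqm hqj (by positivity) (hqn m)
          _ = _ := by ring
    _ = ∑ s ∈ (Finset.Ico n₀ ((n + 1) / (4 * h))).image S,
        (∏ a, q (s a)) * pairGain (r + 2) s := by
        rw [Finset.sum_image hinj]
    _ ≤ _ := by
        refine Finset.sum_le_sum_of_subset_of_nonneg ?_ fun s _ _ =>
          mul_nonneg (Finset.prod_nonneg fun _ _ => hqn _) (pairGain_nonneg _ _)
        intro s hs
        obtain ⟨i, hi, rfl⟩ := Finset.mem_image.1 hs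
        have hb := hbound i hi
        rw [Finset.Nat.mem_antidiagonalTuple]
        simp only [hS, Fin.sum_univ_succ, Fin.cons_zero, Fin.cons_succ, Finset.sum_const,
          Finset.card_univ, Fintype.card_fin, smul_eq_mul, mul_one]
        omega

lemma exists_le_sum_mul_sum_prod_mul_pairGain (hp : ∀ i, 0 ≤ p i) {r h n₀ : ℕ} (hh : 0 < h)
    (hr : h ∣ r + 2) (hpr : p (r + 2) ≠ 0) (hq1 : 0 < q 1) (hc : 0 < c) (hC : 0 < C)
    (hqn : ∀ n, 0 ≤ q n) (hU : ∀ n : ℕ, 1 ≤ n → q n ≤ C / (n * √n))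
    (hL : ∀ n : ℕ, 1 ≤ n → n₀ ≤ n → h ∣ n - 1 → c / (n * √n) ≤ q n) :
    ∃ κ > 0, ∃ L ≥ 0, ∀ n, h ∣ n → q (n + 1) * (κ * Real.log (n + 1 : ℕ) - L) ≤
      ∑ k ∈ range (n + 1), p k * ∑ s ∈ Finset.Nat.antidiagonalTuple k n,
        (∏ i, q (s i)) * pairGain k s := by
  have hpr' : 0 < p (r + 2) := lt_of_le_of_ne (hp _) hpr.symm
  have hh' : (0 : ℝ) < h := by exact_mod_cast hh
  set A := p (r + 2) * (q 1 ^ r * c ^ 2 / h) with hA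
  have hA0 : 0 < A := by positivity
  set R := Real.log (4 * h : ℕ) + ∑ i ∈ range n₀, ((i : ℝ) + 1)⁻¹ with hR
  have hR0 : 0 ≤ R := add_nonneg (Real.log_natCast_nonneg _)
    (Finset.sum_nonneg fun i _ => by positivity)
  set B := 4 * (n₀ + r + 2) with hB
  have hB0 : 0 ≤ Real.log B := Real.log_natCast_nonneg _
  refine ⟨A / C, by positivity, A / C * (R + Real.log B), by positivity, fun n hd => ?_⟩
  have hterm : ∀ k ∈ range (n + 1), 0 ≤ p k * ∑ s ∈ Finset.Nat.antidiagonalTuple k n,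
      (∏ i, q (s i)) * pairGain k s := fun k _ => mul_nonneg (hp k) (Finset.sum_nonneg fun s _ =>
    mul_nonneg (Finset.prod_nonneg fun _ _ => hqn _) (pairGain_nonneg _ _))
  have hn0 : (0 : ℝ) < (n + 1 : ℕ) := by positivity
  have hs0 : 0 < √((n + 1 : ℕ) : ℝ) := Real.sqrt_pos.2 hn0
  by_cases hX : Real.log (n + 1 : ℕ) - (R + Real.log B) ≤ 0
  · refine le_trans ?_ (Finset.sum_nonneg hterm)
    refine mul_nonpos_of_nonneg_of_nonpos (hqn _) ?_
    rw [← mul_sub]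
    exact mul_nonpos_of_nonneg_of_nonpos (by positivity) hX
  · push Not at hX
    have hBn : B ≤ n + 1 := by
      by_contra hlt
      have : Real.log (n + 1 : ℕ) ≤ Real.log B :=
        Real.log_le_log hn0 (by exact_mod_cast (not_le.1 hlt).le)
      linarith
    refine le_trans ?_ (Finset.single_le_sum hterm (mem_range.2 (by omega : r + 2 < n + 1)))
    have h1 := sum_prod_mul_pairGain_ge hh hr hc hqn hL hd hBn
    have h2 := log_sub_le_sum_Ico n₀ (b := 4 * h) (n := n + 1) (by omega) (by omega)
    have h3 := hU (n + 1) (by omega)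
    calc _ ≤ C / ((n + 1 : ℕ) * √(n + 1 : ℕ)) *
          (A / C * (Real.log (n + 1 : ℕ) - R)) := by
          refine mul_le_mul h3 ?_ ?_ (by positivity)
          · rw [← mul_sub]
            refine mul_le_mul_of_nonneg_left (by linarith) (by positivity)
          · rw [← mul_sub]
            exact mul_nonneg (by positivity) hX.le
      _ = p (r + 2) * (q 1 ^ r * c ^ 2 / h / ((n + 1 : ℕ) * √(n + 1 : ℕ)) *
          (Real.log (n + 1 : ℕ) - R)) := by
          rw [hA]
          field_simp
      _ ≤ _ := by
          refine mul_le_mul_of_nonneg_left (le_trans ?_ h1) hpr'.le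
          exact mul_le_mul_of_nonneg_left h2 (by positivity)

end TreeSeries

section HeavyTree

lemma add_sub_losses_le {K : ℝ} (hK : 0 ≤ K) {k n : ℕ} (hk : 2 ≤ k) {s : Fin k → ℕ}
    (hs : ∑ a, s a = n) {i j : Fin k} (hij : i ≠ j) (hji : s j ≤ s i)
    (hmax : ∀ l, l ≠ i → s l ≤ s j) :
    (n + 1 : ℕ) + K * √(n + 1 : ℕ) - 1 - K - tripleLoss k n s -
        K / √(n + 1 : ℕ) * pairLoss k n s + K * pairGain k s ≤
      (s i + K * √(s i)) + (s j + K * √(s j)) := by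
  have hmem : n ≤ k * s i := by
    have h1 : ∑ a, s a ≤ ∑ _a : Fin k, s i := Finset.sum_le_sum fun a _ => by
      rcases eq_or_ne a i with rfl | ha
      · exact le_rfl
      · exact (hmax a ha).trans hji
    simpa [hs] using h1
  have hite : ∀ (P : Prop) [Decidable P] (x : ℕ), 0 ≤ if P then (x : ℝ) else 0 := fun P _ x => by
    split_ifs
    · positivity
    · exact le_rfl
  set R := ∑ l, if i ≠ l ∧ j ≠ l then (s l : ℝ) else 0 with hR
  have hn : (n : ℝ) = s i + s j + R := by
    have h1 : ∀ l, (s l : ℝ) = (if i = l then (s l : ℝ) else 0) + (if j = l then (s l : ℝ) else 0) +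
        if i ≠ l ∧ j ≠ l then (s l : ℝ) else 0 := by
      intro l
      by_cases h : i = l
      · have : j ≠ l := fun h' => hij (h.trans h'.symm)
        simp [h, this]
      · by_cases h' : j = l <;> simp [h, h']
    rw [← hs, Nat.cast_sum, Finset.sum_congr rfl fun l _ => h1 l, Finset.sum_add_distrib,
      Finset.sum_add_distrib, Finset.sum_ite_eq, Finset.sum_ite_eq]
    simp [hR]
  have hR0 : 0 ≤ R := Finset.sum_nonneg fun l _ => hite _ _
  have htri : R ≤ tripleLoss k n s := by
    rw [tripleLoss]
    refine le_trans ?_ (Finset.single_le_sum (fun a _ => Finset.sum_nonneg fun b _ =>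
      Finset.sum_nonneg fun l _ => hite _ _) (Finset.mem_univ i))
    refine le_trans ?_ (Finset.single_le_sum (fun b _ =>
      Finset.sum_nonneg fun l _ => hite _ _) (Finset.mem_univ j))
    refine Finset.sum_le_sum fun l _ => ?_
    by_cases h : i ≠ l ∧ j ≠ l
    · rw [if_pos h, if_pos ⟨hij, h.1, h.2, hmem, hmax l h.1.symm⟩]
    · rw [if_neg h]
      exact hite _ _
  have hpair : (n : ℝ) - s i ≤ pairLoss k n s := by
    rw [pairLoss]
    refine le_trans ?_ (Finset.single_le_sum (fun a _ => Finset.sum_nonneg fun b _ =>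
      hite _ _) (Finset.mem_univ i))
    have h1 : (n : ℝ) = s i + ∑ l, if i ≠ l ∧ n ≤ k * s i then (s l : ℝ) else 0 := by
      rw [← hs, Nat.cast_sum, ← Finset.add_sum_erase _ _ (Finset.mem_univ i), hs]
      congr 1
      have h2 : ∀ l, (if i ≠ l ∧ n ≤ k * s i then (s l : ℝ) else 0) =
          if l ≠ i then (s l : ℝ) else 0 := fun l => by
        by_cases h : i = l
        · simp [h]
        · simp [h, Ne.symm h, hmem]
      simp_rw [h2]
      rw [← Finset.sum_filter, Finset.filter_ne']
    linarith
  have hgain : pairGain k s ≤ √(s j) := by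
    rw [pairGain, dif_pos hk]
    refine Real.sqrt_le_sqrt ?_
    rw [Nat.cast_le]
    by_cases h : (⟨0, by omega⟩ : Fin k) = i
    · refine (min_le_right _ _).trans (hmax _ ?_)
      rw [← h]
      simp
    · exact (min_le_left _ _).trans (hmax _ h)
  set N : ℝ := ((n + 1 : ℕ) : ℝ) with hN
  have hNn : N = n + 1 := by rw [hN]; push_cast; rfl
  have hN1 : 1 ≤ N := by rw [hNn]; linarith [(Nat.cast_nonneg n : (0 : ℝ) ≤ n)]
  have hsN : 1 ≤ √N := Real.one_le_sqrt.2 hN1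
  have hsN0 : 0 < √N := by linarith
  have hNN : √N ^ 2 = N := Real.sq_sqrt (by linarith)
  have hroot : √N - 1 - pairLoss k n s / √N ≤ √(s i) := by
    have hi0 : (0 : ℝ) ≤ s i := Nat.cast_nonneg _
    have hj0 : (0 : ℝ) ≤ s j := Nat.cast_nonneg _
    have h1 : (s i : ℝ) ≤ N := by linarith
    have h2 : √(s i : ℝ) ≤ √N := Real.sqrt_le_sqrt h1
    have h3 : √(s i : ℝ) ^ 2 = s i := Real.sq_sqrt hi0
    have h4 : √N - √(s i) ≤ (1 + pairLoss k n s) / √N := by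
      rw [le_div_iff₀ hsN0]
      nlinarith [Real.sqrt_nonneg (s i : ℝ)]
    have h5 : 1 / √N ≤ 1 := by
      rw [div_le_one hsN0]
      exact hsN
    rw [add_div] at h4
    linarith
  have h6 := mul_le_mul_of_nonneg_left hroot hK
  have h7 := mul_le_mul_of_nonneg_left hgain hK
  have h8 : K / √N * pairLoss k n s = K * (pairLoss k n s / √N) := by ring
  rw [h8]
  linarith

variable {p : ℕ → ℝ}

lemma prod_treeSum_mul_losses_le (hp : ∀ i, 0 ≤ p i) {K ε : ℝ} (hK : 0 ≤ K) (hε : 0 ≤ ε)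
    {k n : ℕ} (hn : 1 ≤ n) {s : Fin k → ℕ} (hs : ∑ a, s a = n)
    (hb : ∀ m ≤ n, treeSum p m * (ε * (m + K * √m) - 1 / 2) ≤ heavyMass p m) :
    (∏ i, treeSum p (s i)) * (ε * ((n + 1 : ℕ) + K * √(n + 1 : ℕ) - 1 - K - tripleLoss k n s -
        K / √(n + 1 : ℕ) * pairLoss k n s + K * pairGain k s)) ≤
      ∑ t ∈ Fintype.piFinset (fun i => PTree.ofSize (s i)),
        (∏ i, weight p (t i)) * heavySize 2 (.node (List.ofFn t)) := by
  have hprod : 0 ≤ ∏ i, treeSum p (s i) := Finset.prod_nonneg fun i _ => treeSum_nonneg hp _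
  have hsn : ∀ i, s i ≤ n := fun i => by
    rw [← hs]
    exact Finset.single_le_sum (f := s) (fun _ _ => Nat.zero_le _) (Finset.mem_univ i)
  have hb' := fun i => hb (s i) (hsn i)
  match k, s, hs, hprod, hsn, hb' with
  | 0, s, hs, _, _, _ => simp at hs; omega
  | 1, s, hs, hprod, _, hb' =>
    refine le_trans ?_ (prod_treeSum_mul_one_heavy_le hp s (hb' 0))
    refine mul_le_mul_of_nonneg_left ?_ hprod
    have h0 : s 0 = n := by simpa using hs
    have h1 : tripleLoss 1 n s = 0 := by simp [tripleLoss]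
    have h2 : pairLoss 1 n s = 0 := by simp [pairLoss]
    have h3 : pairGain 1 s = 0 := by simp [pairGain]
    have h4 : √((n + 1 : ℕ) : ℝ) ≤ √(n : ℝ) + 1 := by
      refine Real.sqrt_le_iff.2 ⟨by positivity, ?_⟩
      rw [add_sq, Real.sq_sqrt (Nat.cast_nonneg n)]
      push_cast
      linarith [Real.sqrt_nonneg (n : ℝ)]
    rw [h1, h2, h3, h0, mul_zero, mul_zero]
    have h5 := mul_le_mul_of_nonneg_left h4 hK
    have h6 : ((n + 1 : ℕ) : ℝ) + K * √(n + 1 : ℕ) - 1 - K - 0 - 0 + 0 ≤ n + K * √n := by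
      push_cast at h5 ⊢
      linarith
    linarith [mul_le_mul_of_nonneg_left h6 hε]
  | k + 2, s, hs, hprod, _, hb' =>
    obtain ⟨i, j, hij, hji, hmax, h⟩ := prod_treeSum_mul_two_heavy_le hp (by omega) s
      (b := fun m => ε * (m + K * √m) - 1 / 2) hb'
    refine le_trans ?_ h
    refine mul_le_mul_of_nonneg_left ?_ hprod
    have := mul_le_mul_of_nonneg_left (add_sub_losses_le hK (by omega) hs hij hji hmax) hε
    linarith

lemma treeSum_le_heavyMass (hp : ∀ i, 0 ≤ p i) (n : ℕ) : treeSum p n ≤ heavyMass p n := by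
  rw [treeSum_eq, heavyMass]
  refine Finset.sum_le_sum fun T _ => le_mul_of_one_le_right (weight_nonneg hp T) ?_
  obtain ⟨ts⟩ := T
  rw [heavySize]
  push_cast
  linarith [(Nat.cast_nonneg _ : (0 : ℝ) ≤ (heavySizeAux 2 (ts.map PTree.size) 0 ts : ℕ))]

lemma exists_treeSum_mul_le_heavyMass (hp : ∀ i, 0 ≤ p i) (hs : HasSum p 1)
    (hm : HasSum (fun i : ℕ => (i : ℝ) * p i) 1) {s2 : ℝ} (hs2 : 0 < s2)
    (hv : HasSum (fun i : ℕ => ((i : ℝ) - 1) ^ 2 * p i) s2)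
    (h5 : Summable fun i : ℕ => (i : ℝ) ^ 5 * p i) (h0 : p 0 ≠ 0) {r : ℕ} (hr : p (r + 2) ≠ 0) :
    ∃ ε > 0, ∃ K > 0, ∀ n, treeSum p n * (ε * (n + K * √n) - 1 / 2) ≤ heavyMass p n := by
  have hqn := treeSum_nonneg hp
  obtain ⟨h, hh, hdvd, c, hc, C, hC, n₀, hU, hlat, hlow⟩ := tree_series_bounds hp hs hm hs2 hv h0
    (Nat.succ_ne_zero _) hr (treeSum_zero p) (treeSum_succ p)
  have hQ := sum_range_tree_series_le_one hp hs hqn (treeSum_zero p) (treeSum_succ p)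
  have hq1 : 0 < treeSum p 1 := by
    rw [treeSum_succ p 0]
    simpa using lt_of_le_of_ne (hp 0) h0.symm
  obtain ⟨κ, hκ, L, hL, hgain⟩ := exists_le_sum_mul_sum_prod_mul_pairGain hp hh (hdvd _ hr) hr hq1 hc
    hC hqn hU hlat
  have hM : 0 ≤ ∑' i : ℕ, (i : ℝ) ^ 5 * p i := tsum_nonneg fun i => mul_nonneg (by positivity) (hp i)
  set C₂ := 12 * C ^ 2 * (∑' i : ℕ, (i : ℝ) ^ 5 * p i) / c with hC₂
  set C₃ := 16 * C ^ 3 * (∑' i : ℕ, (i : ℝ) ^ 5 * p i) / c with hC₃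
  have hC₂0 : 0 ≤ C₂ := by positivity
  have hC₃0 : 0 ≤ C₃ := by positivity
  set K := (C₃ + 1) / κ with hK
  have hK0 : 0 < K := by positivity
  have hKκ : K * κ = C₃ + 1 := by rw [hK]; field_simp
  set D := 1 + K + C₃ + K * C₂ + K * L with hD
  have hD0 : 1 + K ≤ D := by
    have : 0 ≤ K * C₂ + K * L := by positivity
    linarith
  have hε : 0 < 1 / (2 * D) := by
    have : 0 < D := by linarith
    positivity
  have hεD : 1 / (2 * D) * D = 1 / 2 := by
    have : D ≠ 0 := by linarith
    field_simp
  set ε := 1 / (2 * D)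
  refine ⟨ε, hε, K, hK0, fun n => ?_⟩
  induction n using Nat.strong_induction_on with
  | _ n ih =>
  rcases (hqn n).eq_or_lt with hq0 | hq0
  · rw [← hq0, zero_mul]
    exact heavyMass_nonneg hp n
  match n, ih, hq0 with
  | 0, _, hq0 => simp [treeSum_zero] at hq0
  | 1, _, hq0 =>
    refine le_trans (mul_le_of_le_one_right hq0.le ?_) (treeSum_le_heavyMass hp 1)
    rw [Nat.cast_one, Real.sqrt_one, mul_one]
    linarith [mul_le_mul_of_nonneg_left hD0 hε.le]
  | n + 2, ih, hq0 =>
    set N : ℝ := ((n + 1 + 1 : ℕ) : ℝ) with hN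
    have hsN : 0 < √N := Real.sqrt_pos.2 (by rw [hN]; positivity)
    obtain ⟨hd, hlow'⟩ := hlow (n + 1 + 1) (by omega) hq0
    have e1 := sum_mul_sum_prod_mul_pairLoss_le hp h5 hC.le hc hqn hU hQ (n := n + 1) (by omega) hlow'
    have e2 := sum_mul_sum_prod_mul_tripleLoss_le hp h5 hC.le hc hqn hU hQ (n := n + 1) (by omega)
      hlow'
    have e3 := hgain (n + 1) hd
    have hlogN : 0 ≤ Real.log N := Real.log_natCast_nonneg _
    have hmass : ε * (treeSum p (n + 1 + 1) * (N + K * √N - 1 - K) -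
        (∑ k ∈ range (n + 1 + 1), p k * ∑ s ∈ Finset.Nat.antidiagonalTuple k (n + 1),
          (∏ i, treeSum p (s i)) * tripleLoss k (n + 1) s) -
        K / √N * (∑ k ∈ range (n + 1 + 1), p k * ∑ s ∈ Finset.Nat.antidiagonalTuple k (n + 1),
          (∏ i, treeSum p (s i)) * pairLoss k (n + 1) s) +
        K * (∑ k ∈ range (n + 1 + 1), p k * ∑ s ∈ Finset.Nat.antidiagonalTuple k (n + 1),
          (∏ i, treeSum p (s i)) * pairGain k s)) ≤ heavyMass p (n + 1 + 1) := by
      rw [heavyMass_succ, treeSum_succ]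
      simp only [Finset.mul_sum, Finset.sum_mul, ← Finset.sum_sub_distrib, ← Finset.sum_add_distrib]
      refine Finset.sum_le_sum fun k _ => Finset.sum_le_sum fun s hs' => ?_
      rw [← Finset.mul_sum]
      have := mul_le_mul_of_nonneg_left (prod_treeSum_mul_losses_le hp hK0.le hε.le
        (by omega : 1 ≤ n + 1) (Finset.Nat.mem_antidiagonalTuple.1 hs')
        fun m hm => ih m (by omega)) (hp k)
      refine le_trans (le_of_eq ?_) this
      rw [← hN]
      ring
    refine le_trans ?_ hmass
    have e1' := mul_le_mul_of_nonneg_left e1 (by positivity : 0 ≤ K / √N)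
    have e1'' : K / √N * (C₂ * (treeSum p (n + 1 + 1) * √((n + 1 + 1 : ℕ) : ℝ))) =
        K * C₂ * treeSum p (n + 1 + 1) := by
      rw [← hN]
      field_simp
    rw [e1''] at e1'
    have e3' := mul_le_mul_of_nonneg_left e3 hK0.le
    have e3'' : K * (treeSum p (n + 1 + 1) * (κ * Real.log ((n + 1 + 1 : ℕ) : ℝ) - L)) =
        treeSum p (n + 1 + 1) * ((C₃ + 1) * Real.log N - K * L) := by
      rw [← hKκ, ← hN]
      ring
    rw [e3''] at e3'
    have hqlog : 0 ≤ treeSum p (n + 1 + 1) * Real.log N := mul_nonneg hq0.le hlogN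
    have hfin : treeSum p (n + 1 + 1) * (N + K * √N - D) ≤ _ :=
      le_trans (b := treeSum p (n + 1 + 1) * (N + K * √N - 1 - K) -
        C₃ * (treeSum p (n + 1 + 1) * (1 + Real.log N)) - K * C₂ * treeSum p (n + 1 + 1) +
        treeSum p (n + 1 + 1) * ((C₃ + 1) * Real.log N - K * L)) (by rw [hD]; linarith)
        (add_le_add (sub_le_sub (sub_le_sub_left e2 _) e1') e3')
    refine le_trans (le_of_eq ?_) (mul_le_mul_of_nonneg_left hfin hε.le)
    rw [← hεD]
    change treeSum p (n + 1 + 1) * _ = _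
    ring

end HeavyTree

end HeavyTreeSize

/-- lower bound for the expected size of the 2-heavy tree of `τ_n`. -/
theorem stmt_9 (p : ℕ → ℝ)
    (hp_nonneg : ∀ i, 0 ≤ p i)
    (hp_sum : ∑' i : ℕ, p i = 1)
    (hp_mean : ∑' i : ℕ, (i : ℝ) * p i = 1)
    (hp_sq : Summable (fun i : ℕ => (i : ℝ) ^ 2 * p i))
    (hp_var : 1 < ∑' i : ℕ, (i : ℝ) ^ 2 * p i)
    (hmom : MomentFinite p 5) :
    ∃ ν₁ ν₂ : ℝ, 0 < ν₁ ∧ 0 < ν₂ ∧ ∀ n ∈ gwSupport p,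
      ν₁ * (n : ℝ) + ν₂ * Real.sqrt n - 1 / 2 ≤
        condExp p n (fun T => (heavySize 2 T : ℝ)) := by
  have hs : HasSum p 1 := by
    have : Summable p := by
      by_contra h
      simp [tsum_eq_zero_of_not_summable h] at hp_sum
    exact hp_sum ▸ this.hasSum
  have hm : HasSum (fun i : ℕ => (i : ℝ) * p i) 1 := by
    have : Summable fun i : ℕ => (i : ℝ) * p i := by
      by_contra h
      simp [tsum_eq_zero_of_not_summable h] at hp_mean
    exact hp_mean ▸ this.hasSum
  have hv : HasSum (fun i : ℕ => ((i : ℝ) - 1) ^ 2 * p i)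
      ((∑' i : ℕ, (i : ℝ) ^ 2 * p i) - 2 * 1 + 1) := by
    have he : (fun i : ℕ => ((i : ℝ) - 1) ^ 2 * p i) =
        fun i : ℕ => (i : ℝ) ^ 2 * p i - 2 * ((i : ℝ) * p i) + p i := by
      funext i
      ring
    rw [he]
    exact (hp_sq.hasSum.sub (hm.mul_left 2)).add hs
  have hne : ¬∀ i : ℕ, (i : ℝ) * ((i - 1) * p i) = 0 := by
    intro h
    have : ∑' i : ℕ, (i : ℝ) ^ 2 * p i = ∑' i : ℕ, (i : ℝ) * p i :=
      tsum_congr fun i => by linear_combination h i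
    linarith
  have h5 : Summable fun i : ℕ => (i : ℝ) ^ 5 * p i := by
    refine hmom.congr fun i => ?_
    rw [show (5 : ℝ) = (5 : ℕ) by norm_num, Real.rpow_natCast]
  have h0 : p 0 ≠ 0 := by
    intro h0
    have hz : HasSum (fun i : ℕ => (i : ℝ) * p i - p i) 0 := by simpa using hm.sub hs
    have hnn : ∀ i : ℕ, 0 ≤ (i : ℝ) * p i - p i := by
      rintro (_ | i)
      · simp [h0]
      · have := mul_nonneg (Nat.cast_nonneg (α := ℝ) i) (hp_nonneg (i + 1))
        push_cast
        linarith
    have := (hasSum_zero_iff_of_nonneg hnn).1 hz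
    refine hne fun i => ?_
    have hi : (i : ℝ) * p i - p i = 0 := congrFun this i
    rw [sub_mul, one_mul, hi, mul_zero]
  obtain ⟨r, hr⟩ : ∃ r, p (r + 2) ≠ 0 := by
    by_contra! h
    refine hne fun i => ?_
    match i with
    | 0 => simp
    | 1 => simp
    | i + 2 => simp [h i]
  obtain ⟨ε, hε, K, hK, hmain⟩ := exists_treeSum_mul_le_heavyMass hp_nonneg hs hm (by linarith) hv
    h5 h0 hr
  refine ⟨ε, ε * K, hε, by positivity, fun n hn => ?_⟩
  rw [condExp_heavySize, le_div_iff₀ hn.2]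
  linarith [hmain n]
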